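/- Every infinite sequence ⟨G_{V_n} : n < ω⟩ of Gödel logics determined by countable Gödel sets V_n is good with respect to reverse inclusion: there exist n < m with G_{V_n} ⊇ G_{V_m}. That is, the set of Gödel logics with countable truth value set, ordered by ⊇, is a wqo. -/

import Mathlib

open Set

/-- Formulas of a relational first-order language with countably many predicate
symbols (symbol `p` has arity `ar p`); variables are de Bruijn indices. -/
inductive GFormula (ar : ℕ → ℕ) : Type
  | bot : GFormula ar
  | atom (p : ℕ) (ts : Fin (ar p) → ℕ) : GFormula ar
  | conj : GFormula ar → GFormula ar → GFormula ar
  | disj : GFormula ar → GFormula ar → GFormula ar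
  | imp : GFormula ar → GFormula ar → GFormula ar
  | all : GFormula ar → GFormula ar
  | ex : GFormula ar → GFormula ar

/-- All free variables of the formula are `< k`. -/
def GFormula.VarsBelow {ar : ℕ → ℕ} : ℕ → GFormula ar → Prop
  | _, .bot => True
  | k, .atom _ ts => ∀ i, ts i < k
  | k, .conj φ ψ => φ.VarsBelow k ∧ ψ.VarsBelow k
  | k, .disj φ ψ => φ.VarsBelow k ∧ ψ.VarsBelow k
  | k, .imp φ ψ => φ.VarsBelow k ∧ ψ.VarsBelow k
  | k, .all φ => φ.VarsBelow (k+1)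
  | k, .ex φ => φ.VarsBelow (k+1)

/-- A closed formula (sentence). -/
def GFormula.IsClosedF {ar : ℕ → ℕ} (φ : GFormula ar) : Prop := φ.VarsBelow 0

/-- The syntactic subformulas of a formula. -/
def GFormula.Subfs {ar : ℕ → ℕ} : GFormula ar → Set (GFormula ar)
  | .bot => {.bot}
  | .atom p ts => {.atom p ts}
  | .conj φ ψ => insert (.conj φ ψ) (φ.Subfs ∪ ψ.Subfs)
  | .disj φ ψ => insert (.disj φ ψ) (φ.Subfs ∪ ψ.Subfs)
  | .imp φ ψ => insert (.imp φ ψ) (φ.Subfs ∪ ψ.Subfs)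
  | .all φ => insert (.all φ) φ.Subfs
  | .ex φ => insert (.ex φ) φ.Subfs

/-- A Gödel set: a closed subset of `[0,1]` containing `0` and `1`. -/
def GodelSet (V : Set ℝ) : Prop :=
  IsClosed V ∧ V ⊆ Set.Icc (0:ℝ) 1 ∧ (0:ℝ) ∈ V ∧ (1:ℝ) ∈ V

/-- A valuation into `V`: a nonempty universe `M` together with interpretations of
all predicate symbols, taking values in `V`. -/
structure GValuation (ar : ℕ → ℕ) (V : Set ℝ) where
  M : Type
  ne : Nonempty M
  interp : ∀ p : ℕ, (Fin (ar p) → M) → ℝ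
  interp_mem : ∀ p t, interp p t ∈ V

/-- Prepend a value to an environment. -/
def consEnv {M : Type} (m : M) (e : ℕ → M) : ℕ → M
  | 0 => m
  | n+1 => e n

/-- The Gödel value of a formula under a valuation and an environment. -/
noncomputable def geval {ar : ℕ → ℕ} {V : Set ℝ} (v : GValuation ar V) :
    (ℕ → v.M) → GFormula ar → ℝ
  | _, .bot => 0
  | e, .atom p ts => v.interp p (fun i => e (ts i))
  | e, .conj φ ψ => min (geval v e φ) (geval v e ψ)
  | e, .disj φ ψ => max (geval v e φ) (geval v e ψ)
  | e, .imp φ ψ => if geval v e φ ≤ geval v e ψ then 1 else geval v e ψ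
  | e, .all φ => sInf (Set.range fun m : v.M => geval v (consEnv m e) φ)
  | e, .ex φ => sSup (Set.range fun m : v.M => geval v (consEnv m e) φ)

/-- The value `v(φ)` of a closed formula. -/
noncomputable def GValuation.val {ar : ℕ → ℕ} {V : Set ℝ}
    (v : GValuation ar V) (φ : GFormula ar) : ℝ :=
  geval v (fun _ => Classical.choice v.ne) φ

/-- `‖φ‖_V`: the infimum of `v(φ)` over all valuations `v` into `V`. -/
noncomputable def GNorm (ar : ℕ → ℕ) (V : Set ℝ) (φ : GFormula ar) : ℝ :=
  sInf (Set.range fun v : GValuation ar V => v.val φ)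

/-- The Gödel logic of `V`: all closed formulas with `‖φ‖_V = 1`. -/
def GLogic (ar : ℕ → ℕ) (V : Set ℝ) : Set (GFormula ar) :=
  {φ | φ.IsClosedF ∧ GNorm ar V φ = 1}

open Filter

/-! ### Partitions of the infinite subsets of `ℕ` -/

/-- `X` end-extends the finite set `q`. -/
def EndExt (q : Finset ℕ) (X : Set ℕ) : Prop :=
  ↑q ⊆ X ∧ ∀ x ∈ X, x ∉ q → ∀ y ∈ q, y < x

/-- `q` is accepted if, along the ultrafilter `U`, almost every end-extension of `q` in `D`
is eventually forced to have colour `true`. -/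
inductive Accepts (U : Ultrafilter ℕ) (D : Set ℕ) (c : Set ℕ → Bool) : Finset ℕ → Prop
  | imm (q : Finset ℕ) (h : ∀ X ⊆ D, X.Infinite → EndExt q X → c X = true) : Accepts U D c q
  | lim (q : Finset ℕ) (E : Set ℕ) (hE : E ∈ U) (h : ∀ n ∈ E, Accepts U D c (insert n q)) :
      Accepts U D c q

theorem EndExt.of_insert {q : Finset ℕ} {n : ℕ} (hn : ∀ y ∈ q, y < n) {X : Set ℕ}
    (h : EndExt (insert n q) X) : EndExt q X := by
  refine ⟨fun x hx => h.1 (by simp_all), fun x hx hxq y hy => ?_⟩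
  by_cases hxn : x = n
  · exact hxn ▸ hn y hy
  · exact h.2 x hx (by simp [hxn, hxq]) y (by simp [hy])

theorem eventually_forall_lt {U : Ultrafilter ℕ} (hU : (U : Filter ℕ) ≤ atTop) (q : Finset ℕ) :
    ∀ᶠ n in (U : Filter ℕ), ∀ y ∈ q, y < n :=
  (Filter.eventually_all_finset q).2 fun y _ => hU (eventually_gt_atTop y)

theorem Accepts.eventually_insert {U : Ultrafilter ℕ} (hU : (U : Filter ℕ) ≤ atTop) {D : Set ℕ}
    {c : Set ℕ → Bool} {q : Finset ℕ} (h : Accepts U D c q) :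
    ∀ᶠ n in (U : Filter ℕ), Accepts U D c (insert n q) := by
  cases h with
  | imm _ h =>
    filter_upwards [eventually_forall_lt hU q] with n hn
    exact .imm _ fun X hX hi he => h X hX hi (he.of_insert hn)
  | lim _ E hE h => exact mem_of_superset hE h

theorem Accepts.exists_extension {U : Ultrafilter ℕ} (hU : (U : Filter ℕ) ≤ atTop) {D : Set ℕ}
    (hDU : D ∈ U) {c : Set ℕ → Bool} {q : Finset ℕ} (h : Accepts U D c q) (hq : ↑q ⊆ D) :
    ∃ X ⊆ D, X.Infinite ∧ EndExt q X ∧ c X = true := by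
  induction h with
  | imm q h =>
    have hE : {n | ∀ y ∈ q, y < n} ∩ D ∈ U := inter_mem (eventually_forall_lt hU q) hDU
    have hi : ({n | ∀ y ∈ q, y < n} ∩ D).Infinite := by
      refine Nat.frequently_atTop_iff_infinite.1 (Frequently.filter_mono ?_ hU)
      exact (show ∀ᶠ n in (U : Filter ℕ), n ∈ {n | ∀ y ∈ q, y < n} ∩ D from hE).frequently
    have he : EndExt q (↑q ∪ ({n | ∀ y ∈ q, y < n} ∩ D)) := by
      refine ⟨subset_union_left, fun x hx hxq y hy => ?_⟩
      rcases hx with hx | hx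
      · exact absurd hx hxq
      · exact hx.1 y hy
    have hs : ↑q ∪ ({n | ∀ y ∈ q, y < n} ∩ D) ⊆ D := union_subset hq inter_subset_right
    exact ⟨_, hs, hi.mono subset_union_right, he, h _ hs (hi.mono subset_union_right) he⟩
  | lim q E hE h ih =>
    obtain ⟨n, ⟨hnE, hnD⟩, hn⟩ := Ultrafilter.nonempty_of_mem
      (inter_mem (inter_mem hE hDU) (eventually_forall_lt hU q))
    obtain ⟨X, hX, hi, he, hc⟩ := ih n hnE (by
      intro x hx
      rcases Finset.mem_insert.1 (Finset.mem_coe.1 hx) with rfl | hx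
      · exact hnD
      · exact hq hx)
    exact ⟨X, hX, hi, he.of_insert hn, hc⟩

/-- A property of finite sets that propagates along `U` holds for all finite subsets of some
infinite set. -/
theorem exists_infinite_forall_finset {U : Ultrafilter ℕ} (hU : (U : Filter ℕ) ≤ atTop)
    {D : Set ℕ} (hDU : D ∈ U) {P : Finset ℕ → Prop} (h0 : P ∅)
    (hP : ∀ q, P q → ∀ᶠ n in (U : Filter ℕ), P (insert n q)) :
    ∃ B ⊆ D, B.Infinite ∧ ∀ q : Finset ℕ, ↑q ⊆ B → P q := by
  have step : ∀ p : {p : Finset ℕ // ↑p ⊆ D ∧ ∀ q ⊆ p, P q},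
      ∃ p' : {p : Finset ℕ // ↑p ⊆ D ∧ ∀ q ⊆ p, P q}, p.1 ⊂ p'.1 := by
    rintro ⟨p, hpD, hp⟩
    have h1 : ∀ᶠ n in (U : Filter ℕ), ∀ q ∈ p.powerset, P (insert n q) :=
      (Filter.eventually_all_finset _).2 fun q hq => hP q (hp q (Finset.mem_powerset.1 hq))
    obtain ⟨n, ⟨hn1, hn2⟩, hn3⟩ := Ultrafilter.nonempty_of_mem
      (inter_mem (inter_mem h1 hDU) (eventually_forall_lt hU p))
    have hnp : n ∉ p := fun h => lt_irrefl _ (hn3 n h)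
    refine ⟨⟨insert n p, ?_, fun q hq => ?_⟩, Finset.ssubset_insert hnp⟩
    · intro x hx
      rcases Finset.mem_insert.1 (Finset.mem_coe.1 hx) with rfl | hx
      · exact hn2
      · exact hpD hx
    · by_cases hnq : n ∈ q
      · rw [← Finset.insert_erase hnq]
        exact hn1 _ (Finset.mem_powerset.2 (Finset.subset_insert_iff.1 hq))
      · exact hp q ((Finset.subset_insert_iff_of_notMem hnq).1 hq)
  choose nxt hnxt using step
  let p : ℕ → {p : Finset ℕ // ↑p ⊆ D ∧ ∀ q ⊆ p, P q} := fun n =>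
    nxt^[n] ⟨∅, by simp, fun q hq => by rwa [Finset.subset_empty.1 hq]⟩
  have hps : ∀ n, (p n).1 ⊂ (p (n + 1)).1 := fun n => by
    simpa only [p, Function.iterate_succ_apply'] using hnxt _
  have hmono : StrictMono fun n => (p n).1 := strictMono_nat_of_lt_succ hps
  refine ⟨⋃ n, ↑(p n).1, iUnion_subset fun n => (p n).2.1, fun hfin => ?_, fun q hq => ?_⟩
  · have hcard : ∀ n, n ≤ (p n).1.card := by
      intro n
      induction n with
      | zero => simp
      | succ n ih => exact lt_of_le_of_lt ih (Finset.card_lt_card (hps n))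
    have := (hcard (hfin.toFinset.card + 1)).trans (Finset.card_le_card (t := hfin.toFinset) (by
      intro x hx
      simp only [Finite.mem_toFinset, mem_iUnion]
      exact ⟨_, hx⟩))
    omega
  · obtain ⟨n, hn⟩ := Directed.exists_mem_subset_of_finset_subset_biUnion
      (f := fun n => (↑(p n).1 : Set ℕ))
      (directed_of_isDirected_le fun a b h => Finset.coe_subset.2 (hmono.monotone h)) hq
    exact (p n).2.2 q (Finset.coe_subset.1 hn)

/-- The clopen Ramsey theorem of Nash-Williams. -/
theorem exists_homogeneous {D : Set ℕ} (hD : D.Infinite) (c : Set ℕ → Bool) (M : Set ℕ → ℕ)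
    (hc : ∀ X ⊆ D, X.Infinite → ∀ Y ⊆ D, Y.Infinite → Y ∩ Iio (M X) = X ∩ Iio (M X) → c Y = c X) :
    ∃ B ⊆ D, B.Infinite ∧ ∃ b, ∀ X ⊆ B, X.Infinite → c X = b := by
  classical
  have hne : (atTop ⊓ 𝓟 D).NeBot := by
    have hD' : ∃ᶠ n in atTop, n ∈ D := Nat.frequently_atTop_iff_infinite.2 hD
    exact frequently_mem_iff_neBot.1 hD'
  let U := Ultrafilter.of (atTop ⊓ 𝓟 D)
  have hU : (U : Filter ℕ) ≤ atTop := (Ultrafilter.of_le _).trans inf_le_left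
  have hDU : D ∈ U := (Ultrafilter.of_le _).trans inf_le_right (mem_principal_self D)
  obtain ⟨B, hBD, hBi, hB⟩ := exists_infinite_forall_finset hU hDU
    (P := fun q => (Accepts U D c q ↔ Accepts U D c ∅)) Iff.rfl (by
      intro q hq
      by_cases h : Accepts U D c q
      · filter_upwards [h.eventually_insert hU] with n hn
        exact iff_of_true hn (hq.1 h)
      · have : ∀ᶠ n in (U : Filter ℕ), ¬ Accepts U D c (insert n q) := by
          rw [Ultrafilter.eventually_not]
          exact fun h' => h (.lim q _ h' fun n hn => hn)
        filter_upwards [this] with n hn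
        exact iff_of_false hn (fun h' => h (hq.2 h')))
  refine ⟨B, hBD, hBi, decide (Accepts U D c ∅), fun X hX hXi => ?_⟩
  obtain ⟨x, hx, hMx⟩ := hXi.exists_gt (M X)
  have hf : (X ∩ Iic x).Finite := (finite_Iic x).subset inter_subset_right
  have hqX : ∀ y, y ∈ hf.toFinset ↔ y ∈ X ∧ y ≤ x := by simp
  have hconst : ∀ Y ⊆ D, Y.Infinite → EndExt hf.toFinset Y → c Y = c X := by
    intro Y hY hYi he
    refine hc X (hX.trans hBD) hXi Y hY hYi ?_
    ext y
    simp only [mem_inter_iff, mem_Iio, and_congr_left_iff]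
    intro hy
    constructor
    · intro hyY
      by_contra hyX
      have := he.2 y hyY (by simp [hyX]) x ((hqX x).2 ⟨hx, le_rfl⟩)
      omega
    · exact fun hyX => he.1 ((hqX y).2 ⟨hyX, by omega⟩)
  have hself : EndExt hf.toFinset X := by
    refine ⟨fun y hy => ((hqX y).1 hy).1, fun y hy hyq z hz => ?_⟩
    have h1 := (hqX z).1 hz
    have h2 : ¬ y ≤ x := fun h => hyq ((hqX y).2 ⟨hy, h⟩)
    omega
  have hqB : (↑hf.toFinset : Set ℕ) ⊆ B := fun y hy => hX (hself.1 hy)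
  rw [← decide_eq_decide.2 (hB _ hqB)]
  cases hcX : c X with
  | true =>
    exact (decide_eq_true (Accepts.imm _ fun Y hY hYi he => (hconst Y hY hYi he).trans hcX)).symm
  | false =>
    refine (decide_eq_false fun h => ?_).symm
    obtain ⟨Y, hY, hYi, he, hcY⟩ := h.exists_extension hU hDU (hqB.trans hBD)
    rw [hconst Y hY hYi he, hcX] at hcY
    exact Bool.false_ne_true hcY

/-! ### The minimal bad array argument -/

/-- A set of natural numbers without its least element. -/
def Set.tail (X : Set ℕ) : Set ℕ := X \ {sInf X}

theorem Set.tail_subset (X : Set ℕ) : X.tail ⊆ X := sdiff_subset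

theorem Set.Infinite.tail {X : Set ℕ} (h : X.Infinite) : X.tail.Infinite :=
  h.sdiff (finite_singleton _)

theorem sInf_eq_of_inter_Iio {X Y : Set ℕ} {k : ℕ} (h : Y ∩ Iio k = X ∩ Iio k) {x : ℕ}
    (hx : x ∈ X) (hk : x < k) : sInf Y = sInf X := by
  have hX : sInf X ∈ X := Nat.sInf_mem ⟨x, hx⟩
  have hXY : sInf X ∈ Y ∩ Iio k := h ▸ ⟨hX, (Nat.sInf_le hx).trans_lt hk⟩
  have hYX : sInf Y ∈ X ∩ Iio k :=
    h ▸ ⟨Nat.sInf_mem ⟨_, hXY.1⟩, (Nat.sInf_le hXY.1).trans_lt hXY.2⟩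
  exact le_antisymm (Nat.sInf_le hXY.1) (Nat.sInf_le hYX.1)

theorem inter_Iio_eq_of_le {X Y : Set ℕ} {j k : ℕ} (h : Y ∩ Iio k = X ∩ Iio k) (hjk : j ≤ k) :
    Y ∩ Iio j = X ∩ Iio j := by
  rw [← inter_eq_self_of_subset_right (Iio_subset_Iio hjk), ← inter_assoc, h, inter_assoc]

theorem tail_inter_Iio {X Y : Set ℕ} {k : ℕ} (h : Y ∩ Iio k = X ∩ Iio k) {x : ℕ}
    (hx : x ∈ X) (hk : x < k) : Y.tail ∩ Iio k = X.tail ∩ Iio k := by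
  ext y
  have := Set.ext_iff.1 h y
  simp only [Set.tail, sInf_eq_of_inter_Iio h hx hk, mem_inter_iff, Set.mem_sdiff] at this ⊢
  tauto

variable {Q : Type*}

/-- A bad array on the infinite subsets of `A.1`: every infinite `X ⊆ A.1` is sent to an element
`(A.2 X).2` that depends only on the elements of `X` below `(A.2 X).1`. -/
structure IsBadArray (le : Q → Q → Prop) (A : Set ℕ × (Set ℕ → ℕ × Q)) : Prop where
  infinite : A.1.Infinite
  cut : ∀ X ⊆ A.1, X.Infinite → ∃ x ∈ X, (A.2 X).1 = x + 1
  modulus : ∀ X ⊆ A.1, X.Infinite → ∀ Y ⊆ A.1, Y.Infinite →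
    Y ∩ Iio (A.2 X).1 = X ∩ Iio (A.2 X).1 → A.2 Y = A.2 X
  bad : ∀ X ⊆ A.1, X.Infinite → ¬ le (A.2 X).2 (A.2 X.tail).2

/-- `A'` refines `A`: it lives on a smaller set, and each of its values is either unchanged or
smaller and determined later. -/
def ArrayLE (lt : Q → Q → Prop) (A' A : Set ℕ × (Set ℕ → ℕ × Q)) : Prop :=
  A'.1 ⊆ A.1 ∧ ∀ X ⊆ A'.1, X.Infinite →
    A'.2 X = A.2 X ∨ (lt (A'.2 X).2 (A.2 X).2 ∧ (A.2 X).1 ≤ (A'.2 X).1)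

theorem ArrayLE.refl (lt : Q → Q → Prop) (A : Set ℕ × (Set ℕ → ℕ × Q)) : ArrayLE lt A A :=
  ⟨Subset.rfl, fun _ _ _ => .inl rfl⟩

theorem ArrayLE.trans {lt : Q → Q → Prop} (hlt : ∀ a b c, lt a b → lt b c → lt a c)
    {A₁ A₂ A₃ : Set ℕ × (Set ℕ → ℕ × Q)} (h : ArrayLE lt A₁ A₂) (h' : ArrayLE lt A₂ A₃) :
    ArrayLE lt A₁ A₃ := by
  refine ⟨h.1.trans h'.1, fun X hX hi => ?_⟩
  rcases h.2 X hX hi with e | ⟨l, k⟩ <;> rcases h'.2 X (hX.trans h.1) hi with e' | ⟨l', k'⟩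
  · exact .inl (e.trans e')
  · exact .inr (e ▸ ⟨l', k'⟩)
  · exact .inr (e' ▸ ⟨l, k⟩)
  · exact .inr ⟨hlt _ _ _ l l', k'.trans k⟩

theorem ArrayLE.cut_le {lt : Q → Q → Prop} {A' A : Set ℕ × (Set ℕ → ℕ × Q)}
    (h : ArrayLE lt A' A) {X : Set ℕ} (hX : X ⊆ A'.1) (hi : X.Infinite) :
    (A.2 X).1 ≤ (A'.2 X).1 := by
  rcases h.2 X hX hi with e | ⟨-, k⟩
  · rw [e]
  · exact k

theorem IsBadArray.congr_tail {le : Q → Q → Prop} {A : Set ℕ × (Set ℕ → ℕ × Q)}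
    (hA : IsBadArray le A) {X Y : Set ℕ} (hX : X ⊆ A.1) (hXi : X.Infinite) (hY : Y ⊆ A.1)
    (hYi : Y.Infinite) {k : ℕ} (hk : max (A.2 X).1 (A.2 X.tail).1 ≤ k)
    (h : Y ∩ Iio k = X ∩ Iio k) : A.2 Y = A.2 X ∧ A.2 Y.tail = A.2 X.tail := by
  obtain ⟨x, hx, hxk⟩ := hA.cut X hX hXi
  refine ⟨hA.modulus X hX hXi Y hY hYi (inter_Iio_eq_of_le h (le_trans (le_max_left _ _) hk)),
    hA.modulus _ (X.tail_subset.trans hX) hXi.tail _ (Y.tail_subset.trans hY) hYi.tail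
      (inter_Iio_eq_of_le (tail_inter_Iio h hx ?_) (le_trans (le_max_right _ _) hk))⟩
  have := le_trans (le_max_left _ _) hk
  omega

theorem IsBadArray.exists_children {le : Q → Q → Prop} {ch : Bool → Q → Q → Prop}
    (root : ∀ T T', (∀ c t, ch c t T → ∃ t', ch c t' T' ∧ le t t') → le T T')
    {A : Set ℕ × (Set ℕ → ℕ × Q)} (hA : IsBadArray le A) :
    ∃ B ⊆ A.1, B.Infinite ∧ ∀ N, ∃ G, IsBadArray le (B, G) ∧ ∀ X ⊆ B, X.Infinite →
      (∃ c, ch c (G X).2 (A.2 X).2) ∧ (A.2 X).1 ≤ (G X).1 ∧ N < (G X).1 := by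
  have spoil : ∀ T T', ∃ c t, ¬ le T T' → ch c t T ∧ ∀ t', ch c t' T' → ¬ le t t' := by
    intro T T'
    by_cases h : le T T'
    · exact ⟨true, T, fun h' => absurd h h'⟩
    · have := mt (root T T') h
      push Not at this
      obtain ⟨c, t, h1, h2⟩ := this
      exact ⟨c, t, fun _ => ⟨h1, h2⟩⟩
  choose col mv hmv using spoil
  obtain ⟨B, hBA, hBi, b, hb⟩ := exists_homogeneous hA.infinite
    (fun X => col (A.2 X).2 (A.2 X.tail).2) (fun X => max (A.2 X).1 (A.2 X.tail).1) (by
      intro X hX hXi Y hY hYi h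
      obtain ⟨h1, h2⟩ := hA.congr_tail hX hXi hY hYi le_rfl h
      simp only [h1, h2])
  refine ⟨B, hBA, hBi, fun N => ?_⟩
  let K : Set ℕ → ℕ := fun X => max (max (A.2 X).1 (A.2 X.tail).1) N
  have hmem : ∀ X : Set ℕ, X.Infinite → sInf (X ∩ Ici (K X)) ∈ X ∩ Ici (K X) := by
    intro X hX
    obtain ⟨x, hx, hx'⟩ := hX.exists_gt (K X)
    exact Nat.sInf_mem ⟨x, hx, hx'.le⟩
  have hsp := fun X (hX : X ⊆ B) (hXi : X.Infinite) =>
    hmv _ _ (hA.bad X (hX.trans hBA) hXi)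
  refine ⟨fun X => (sInf (X ∩ Ici (K X)) + 1, mv (A.2 X).2 (A.2 X.tail).2),
    ⟨hBi, fun X hX hXi => ⟨_, (hmem X hXi).1, rfl⟩, ?_, ?_⟩, ?_⟩
  · intro X hX hXi Y hY hYi h
    have hm := hmem X hXi
    have hKk : K X ≤ sInf (X ∩ Ici (K X)) + 1 := Nat.le_succ_of_le hm.2
    obtain ⟨h1, h2⟩ := hA.congr_tail (hX.trans hBA) hXi (hY.trans hBA) hYi
      (le_trans (le_max_left _ _) hKk) h
    have hK : K Y = K X := by simp only [K, h1, h2]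
    have : sInf (Y ∩ Ici (K X)) = sInf (X ∩ Ici (K X)) := by
      refine sInf_eq_of_inter_Iio (k := sInf (X ∩ Ici (K X)) + 1) ?_ hm (Nat.lt_succ_self _)
      rw [inter_right_comm, inter_right_comm X, h]
    simp only [h1, h2, hK, this]
  · intro X hX hXi hle
    have h1 := hsp X hX hXi
    have h2 := hsp X.tail (X.tail_subset.trans hX) hXi.tail
    refine h1.2 _ ?_ hle
    have e := (hb X hX hXi).trans (hb X.tail (X.tail_subset.trans hX) hXi.tail).symm
    rw [e]
    exact h2.1
  · intro X hX hXi
    have h1 := (hmem X hXi).2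
    simp only [K, mem_Ici, max_le_iff] at h1
    exact ⟨⟨_, (hsp X hX hXi).1⟩, by simp only [K]; omega, by simp only [K]; omega⟩

theorem IsBadArray.exists_minimal {le lt : Q → Q → Prop}
    (hlt : ∀ a b c, lt a b → lt b c → lt a c)
    {A : Set ℕ × (Set ℕ → ℕ × Q)} (hA : IsBadArray le A) (c : ℕ) :
    ∃ A', IsBadArray le A' ∧ ArrayLE lt A' A ∧ A'.1 ∩ Iio c = A.1 ∩ Iio c ∧
      ∀ A'', IsBadArray le A'' → ArrayLE lt A'' A' → A''.1 ∩ Iio c = A'.1 ∩ Iio c →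
        ∀ X ⊆ A''.1, X.Infinite → (A'.2 X).1 ≤ c → (A''.2 X).1 ≤ c := by
  let K : Set ℕ × (Set ℕ → ℕ × Q) → Set (Set ℕ) := fun A =>
    {q | ∃ X ⊆ A.1, X.Infinite ∧ X ∩ Iio c = q ∧ (A.2 X).1 ≤ c}
  have hK : ∀ A, (K A).Finite := fun A =>
    (finite_Iio c).finite_subsets.subset (by rintro q ⟨X, -, -, rfl, -⟩; exact inter_subset_right)
  obtain ⟨A', ⟨h1, h2, h3⟩, hmin⟩ := (measure fun A => (K A).ncard).wf.has_min
    {A' | IsBadArray le A' ∧ ArrayLE lt A' A ∧ A'.1 ∩ Iio c = A.1 ∩ Iio c}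
    ⟨A, hA, .refl _ _, rfl⟩
  refine ⟨A', h1, h2, h3, fun A'' h1' h2' h3' X hX hXi hXc => ?_⟩
  have hle : (K A').ncard ≤ (K A'').ncard :=
    not_lt.1 (hmin A'' ⟨h1', h2'.trans hlt h2, h3'.trans h3⟩)
  have hsub : K A'' ⊆ K A' := by
    rintro q ⟨X, hX, hXi, hq, hXc⟩
    exact ⟨X, hX.trans h2'.1, hXi, hq, (h2'.cut_le hX hXi).trans hXc⟩
  have heq := eq_of_subset_of_ncard_le hsub hle (hK A')
  obtain ⟨Y, hY, hYi, hYX, hYc⟩ : X ∩ Iio c ∈ K A'' :=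
    heq ▸ ⟨X, hX.trans h2'.1, hXi, rfl, hXc⟩
  rw [h1'.modulus Y hY hYi X hX hXi (inter_Iio_eq_of_le hYX.symm hYc)]
  exact hYc

theorem exists_forall_ge_eq {α : Type*} {lt : Q → Q → Prop} (hwf : WellFounded lt)
    (s : ℕ → α × Q) (hs : ∀ n, s (n + 1) = s n ∨ lt (s (n + 1)).2 (s n).2) :
    ∃ N, ∀ n ≥ N, s n = s N := by
  obtain ⟨_, ⟨N, rfl⟩, hN⟩ := hwf.has_min (range fun n => (s n).2) (range_nonempty _)
  refine ⟨N, fun n hn => ?_⟩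
  induction n, hn using Nat.le_induction with
  | base => rfl
  | succ n hn ih =>
    rcases hs n with h | h
    · exact h.trans ih
    · rw [ih] at h
      exact absurd h (hN _ ⟨n + 1, rfl⟩)

/-- The restriction of a decreasing sequence of bad arrays to the intersection of their
domains. -/
theorem exists_limit {le lt : Q → Q → Prop} (hlt : ∀ a b c, lt a b → lt b c → lt a c)
    (hwf : WellFounded lt) {A : ℕ → Set ℕ × (Set ℕ → ℕ × Q)} (hA : ∀ n, IsBadArray le (A n))
    (hle : ∀ n, ArrayLE lt (A (n + 1)) (A n)) (hD : (⋂ n, (A n).1).Infinite) :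
    ∃ F, IsBadArray le (⋂ n, (A n).1, F) ∧ ∀ n, ArrayLE lt (⋂ n, (A n).1, F) (A n) := by
  have hle' : ∀ n m, n ≤ m → ArrayLE lt (A m) (A n) := by
    intro n m h
    induction m, h using Nat.le_induction with
    | base => exact .refl _ _
    | succ m h ih => exact (hle m).trans hlt ih
  have hsub : ∀ {X : Set ℕ}, X ⊆ ⋂ n, (A n).1 → ∀ n, X ⊆ (A n).1 := fun h n =>
    h.trans (iInter_subset _ n)
  have hev : ∀ X : Set ℕ, ∃ N, X ⊆ ⋂ n, (A n).1 → X.Infinite →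
      ∀ n ≥ N, (A n).2 X = (A N).2 X := by
    intro X
    by_cases h : X ⊆ (⋂ n, (A n).1) ∧ X.Infinite
    · obtain ⟨N, hN⟩ := exists_forall_ge_eq hwf (fun n => (A n).2 X) fun n =>
        ((hle n).2 X (hsub h.1 _) h.2).imp id fun h => h.1
      exact ⟨N, fun _ _ => hN⟩
    · exact ⟨0, fun h1 h2 => absurd ⟨h1, h2⟩ h⟩
  choose N hN using hev
  refine ⟨fun X => (A (N X)).2 X, ⟨hD, ?_, ?_, ?_⟩, fun n => ⟨iInter_subset _ n, fun X hX hXi => ?_⟩⟩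
  · exact fun X hX hXi => (hA (N X)).cut X (hsub hX _) hXi
  · intro X hX hXi Y hY hYi h
    have h1 := hN X hX hXi _ (le_max_left (N X) (N Y))
    have h2 := hN Y hY hYi _ (le_max_right (N X) (N Y))
    simp only [← h1, ← h2] at h ⊢
    exact (hA _).modulus X (hsub hX _) hXi Y (hsub hY _) hYi h
  · intro X hX hXi
    have h1 := hN X hX hXi _ (le_max_left (N X) (N X.tail))
    have h2 := hN X.tail (X.tail_subset.trans hX) hXi.tail _ (le_max_right (N X) (N X.tail))
    simp only [← h1, ← h2]
    exact (hA _).bad X (hsub hX _) hXi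
  · have h1 := hN X hX hXi _ (le_max_left (N X) n)
    simp only [← h1]
    exact (hle' n _ (le_max_right _ _)).2 X (hsub hX _) hXi

theorem IsBadArray.union {le lt : Q → Q → Prop} (hle : ∀ a b c, le a b → le b c → le a c)
    (hlt : ∀ a b, lt a b → le a b) {D : Set ℕ} {F : Set ℕ → ℕ × Q} (hF : IsBadArray le (D, F))
    {B : Set ℕ} (hBD : B ⊆ D) {G : Set ℕ → ℕ × Q} (hG : IsBadArray le (B, G)) {c : ℕ}
    (hGF : ∀ X ⊆ B, X.Infinite → lt (G X).2 (F X).2 ∧ (F X).1 ≤ (G X).1)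
    (hGc : ∀ X ⊆ B, X.Infinite → c ≤ (G X).1)
    (hFc : ∀ X ⊆ B, X.Infinite → c ≤ (F X).1) [∀ X : Set ℕ, Decidable (X ⊆ B)] :
    IsBadArray le (D ∩ Iio c ∪ B, fun X => if X ⊆ B then G X else F X) ∧
      ArrayLE lt (D ∩ Iio c ∪ B, fun X => if X ⊆ B then G X else F X) (D, F) := by
  have hsub : D ∩ Iio c ∪ B ⊆ D := union_subset inter_subset_left hBD
  have key : ∀ {X Y : Set ℕ}, Y ⊆ D ∩ Iio c ∪ B → X ⊆ B → Y ∩ Iio c = X ∩ Iio c → Y ⊆ B := by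
    intro X Y hY hX h y hy
    rcases hY hy with hy' | hy'
    · have h' : y ∈ Y ∩ Iio c := ⟨hy, hy'.2⟩
      rw [h] at h'
      exact hX h'.1
    · exact hy'
  refine ⟨⟨hG.infinite.mono subset_union_right, ?_, ?_, ?_⟩, hsub, fun X hX hXi => ?_⟩
  · intro X hX hXi
    by_cases h : X ⊆ B
    · simpa only [h, if_true] using hG.cut X h hXi
    · simpa only [h, if_false] using hF.cut X (hX.trans hsub) hXi
  · intro X hX hXi Y hY hYi
    by_cases h : X ⊆ B
    · simp only [h, if_true]
      intro e
      have hYB := key hY h (inter_Iio_eq_of_le e (hGc X h hXi))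
      simpa only [hYB, if_true] using hG.modulus X h hXi Y hYB hYi e
    · simp only [h, if_false]
      intro e
      have e' := hF.modulus X (hX.trans hsub) hXi Y (hY.trans hsub) hYi e
      have hYB : ¬ Y ⊆ B := by
        intro hYB
        have := hFc Y hYB hYi
        exact h (key hX hYB (inter_Iio_eq_of_le e.symm (by simp only at e'; rwa [← e'])))
      simpa only [hYB, if_false] using e'
  · intro X hX hXi
    by_cases h : X ⊆ B
    · simpa only [h, X.tail_subset.trans h, if_true] using hG.bad X h hXi
    · by_cases h' : X.tail ⊆ B
      · simp only [h, h', if_true, if_false]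
        exact fun hl => hF.bad X (hX.trans hsub) hXi
          (hle _ _ _ hl (hlt _ _ (hGF _ h' hXi.tail).1))
      · simpa only [h, h', if_false] using hF.bad X (hX.trans hsub) hXi
  · by_cases h : X ⊆ B
    · simpa only [h, if_true] using .inr (hGF X h hXi)
    · simp only [h, if_false, true_or]

/-- Sequences are good for a transitive relation in which every element lies above its children,
and which holds as soon as the children of the left-hand side are dominated, colour by colour, by
children of the right-hand side. -/
theorem exists_lt_of_children {le : Q → Q → Prop} {ch : Bool → Q → Q → Prop}
    (hle : ∀ a b c, le a b → le b c → le a c) (hwf : WellFounded fun t T => ∃ c, ch c t T)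
    (hch : ∀ c t T, ch c t T → le t T)
    (root : ∀ T T', (∀ c t, ch c t T → ∃ t', ch c t' T' ∧ le t t') → le T T') (T : ℕ → Q) :
    ∃ n m, n < m ∧ le (T n) (T m) := by
  classical
  by_contra! hT
  let lt : Q → Q → Prop := Relation.TransGen fun t T => ∃ c, ch c t T
  have hlt : ∀ a b c, lt a b → lt b c → lt a c := fun _ _ _ => Relation.TransGen.trans
  have hltwf : WellFounded lt := hwf.transGen
  have hltle : ∀ a b, lt a b → le a b := by
    intro a b h
    induction h with
    | single h => exact hch _ _ _ h.choose_spec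
    | tail _ h ih => exact hle _ _ _ ih (hch _ _ _ h.choose_spec)
  have h0 : IsBadArray le (univ, fun X => (sInf X + 1, T (sInf X))) := by
    refine ⟨infinite_univ, fun X _ hX => ⟨_, Nat.sInf_mem hX.nonempty, rfl⟩, ?_, ?_⟩
    · intro X _ hX Y _ hY h
      have := sInf_eq_of_inter_Iio h (Nat.sInf_mem hX.nonempty) (Nat.lt_succ_self _)
      simp only [this]
    · intro X _ hX
      have h1 := Nat.sInf_mem hX.tail.nonempty
      exact hT _ _ (lt_of_le_of_ne (Nat.sInf_le h1.1) (Ne.symm h1.2))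
  choose stage hs1 hs2 hs3 hs4 using fun (A : {A // IsBadArray le A}) (c : ℕ) =>
    A.2.exists_minimal hlt c
  let nxt : {A // IsBadArray le A} × ℕ → {A // IsBadArray le A} × ℕ := fun s =>
    (⟨stage s.1 s.2, hs1 s.1 s.2⟩, sInf ((stage s.1 s.2).1 ∩ Ici s.2) + 1)
  let s : ℕ → {A // IsBadArray le A} × ℕ := fun n => nxt^[n] (⟨_, h0⟩, 0)
  have hsn : ∀ n, s (n + 1) = nxt (s n) := fun n => Function.iterate_succ_apply' _ _ _
  let A : ℕ → Set ℕ × (Set ℕ → ℕ × Q) := fun n => (s n).1.1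
  let c : ℕ → ℕ := fun n => (s n).2
  have hA : ∀ n, IsBadArray le (A n) := fun n => (s n).1.2
  have hAs : ∀ n, A (n + 1) = stage (s n).1 (c n) := fun n => by simp only [A, hsn]; rfl
  have hAle : ∀ n, ArrayLE lt (A (n + 1)) (A n) := fun n => by rw [hAs]; exact hs2 _ _
  have hcut : ∀ n, (A (n + 1)).1 ∩ Iio (c n) = (A n).1 ∩ Iio (c n) := fun n => by
    rw [hAs]; exact hs3 _ _
  have hc : ∀ n, c (n + 1) = sInf ((A (n + 1)).1 ∩ Ici (c n)) + 1 := fun n => by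
    rw [hAs]; simp only [c, hsn]; rfl
  have hy : ∀ n, sInf ((A (n + 1)).1 ∩ Ici (c n)) ∈ (A (n + 1)).1 ∩ Ici (c n) := fun n => by
    obtain ⟨x, hx, hx'⟩ := (hA (n + 1)).infinite.exists_gt (c n)
    exact Nat.sInf_mem ⟨x, hx, hx'.le⟩
  have hcs : StrictMono c := strictMono_nat_of_lt_succ fun n => by
    have := (hy n).2
    rw [hc, Nat.lt_succ_iff]
    exact this
  have hanti : Antitone fun n => (A n).1 := antitone_nat_of_succ_le fun n => (hAle n).1
  have hcut' : ∀ n m, n ≤ m → (A m).1 ∩ Iio (c n) = (A n).1 ∩ Iio (c n) := by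
    intro n m h
    induction m, h using Nat.le_induction with
    | base => rfl
    | succ m h ih => exact (inter_Iio_eq_of_le (hcut m) (hcs.monotone h)).trans ih
  have hcutD : ∀ n, (⋂ n, (A n).1) ∩ Iio (c n) = (A n).1 ∩ Iio (c n) := by
    intro n
    refine Subset.antisymm (inter_subset_inter_left _ (iInter_subset _ n)) ?_
    rintro x ⟨hx, hxc⟩
    refine ⟨mem_iInter.2 fun m => ?_, hxc⟩
    rcases le_total n m with h | h
    · have h' : x ∈ (A n).1 ∩ Iio (c n) := ⟨hx, hxc⟩
      rw [← hcut' n m h] at h'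
      exact h'.1
    · exact hanti h hx
  have hyD : ∀ n, sInf ((A (n + 1)).1 ∩ Ici (c n)) ∈ ⋂ n, (A n).1 := by
    intro n
    have : sInf ((A (n + 1)).1 ∩ Ici (c n)) ∈ (A (n + 1)).1 ∩ Iio (c (n + 1)) :=
      ⟨(hy n).1, by rw [hc]; exact Nat.lt_succ_self _⟩
    rw [← hcutD] at this
    exact this.1
  have hDi : (⋂ n, (A n).1).Infinite := by
    refine Nat.frequently_atTop_iff_infinite.1 (frequently_atTop.2 ?_)
    exact fun n => ⟨_, (hcs.id_le n).trans (hy n).2, hyD n⟩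
  have hDy : ∀ x ∈ ⋂ n, (A n).1, ∃ n, x + 1 = c (n + 1) := by
    intro x hx
    have hex : ∃ n, x < c n := ⟨x + 1, lt_of_lt_of_le (Nat.lt_succ_self x) (hcs.id_le (x + 1))⟩
    have hmin := fun {m} => Nat.find_min (m := m) hex
    have hlt := Nat.find_spec hex
    rcases hn : Nat.find hex with - | j
    · rw [hn] at hlt
      exact absurd hlt (Nat.not_lt_zero _)
    · rw [hn] at hlt hmin
      have h1 : c j ≤ x := not_lt.1 (hmin (Nat.lt_succ_self j))
      have h2 : sInf ((A (j + 1)).1 ∩ Ici (c j)) ≤ x := Nat.sInf_le ⟨mem_iInter.1 hx _, h1⟩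
      have h3 := hc j
      exact ⟨j, by omega⟩
  obtain ⟨F, hF, hFA⟩ := exists_limit hlt hltwf hA hAle hDi
  obtain ⟨B, hBD, hBi, hB⟩ := hF.exists_children root
  obtain ⟨X₀, ⟨hX₀B, hX₀i⟩, hX₀⟩ := (measure fun X => (F X).1).wf.has_min
    {X | X ⊆ B ∧ X.Infinite} ⟨B, Subset.rfl, hBi⟩
  obtain ⟨x, hx, hxF⟩ := hF.cut X₀ (hX₀B.trans hBD) hX₀i
  obtain ⟨n, hn⟩ := hDy x (hBD (hX₀B hx))
  simp only at hxF
  obtain ⟨G, hG, hGF⟩ := hB (c (n + 1))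
  have hU := hF.union hle hltle hBD hG (c := c (n + 1))
    (fun X hX hXi => ⟨.single (hGF X hX hXi).1, (hGF X hX hXi).2.1⟩)
    (fun X hX hXi => (hGF X hX hXi).2.2.le)
    (fun X hX hXi => by
      have : ¬ (F X).1 < (F X₀).1 := hX₀ X ⟨hX, hXi⟩
      omega)
  have hU' := hU.2.trans hlt (hFA (n + 2))
  have hmin := hs4 (s (n + 1)).1 (c (n + 1))
  rw [← hAs] at hmin
  have := hmin _ hU.1 hU' (by
    exact (Subset.antisymm (inter_subset_inter_left _ hU.2.1)
      fun x hx => ⟨subset_union_left hx, hx.2⟩).trans ((hcutD (n + 1)).trans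
        (hcut (n + 1)).symm)) X₀ (hX₀B.trans subset_union_right) hX₀i (by
      have := (hFA (n + 1 + 1)).cut_le (hX₀B.trans hBD) hX₀i
      simp only at this
      omega)
  simp only [hX₀B, if_true] at this
  have := (hGF X₀ hX₀B hX₀i).2.2
  omega

/-! ### Codes for countable closed sets of reals -/

/-- Codes for the trace of a countable closed set on an open interval: the trace is empty, or it
contains a point which is approached from both sides by a sequence of coded pieces, from the left
by those in `f true` and from the right by those in `f false`. -/
inductive Code : Type
  | empty : Code
  | node (f : Bool → ℕ → Code) : Code

namespace Code

/-- `IsChild c t T`: the code `t` occurs on the side `c` of `T`. -/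
def IsChild (c : Bool) (t : Code) : Code → Prop
  | empty => False
  | node f => ∃ i, t = f c i

/-- The embeddability quasi-order on codes. -/
inductive Le : Code → Code → Prop
  | empty (t : Code) : Le empty t
  | root {f f' : Bool → ℕ → Code} (k : Bool → ℕ → ℕ) (h : ∀ c i, Le (f c i) (f' c (k c i))) :
      Le (node f) (node f')
  | sub {t : Code} {f' : Bool → ℕ → Code} (c : Bool) (j : ℕ) (h : Le t (f' c j)) : Le t (node f')

theorem Le.refl (t : Code) : Le t t := by
  induction t with
  | empty => exact .empty _
  | node f ih => exact .root (fun _ i => i) ih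

theorem Le.trans {a b c : Code} (h : Le a b) (h' : Le b c) : Le a c := by
  induction h' generalizing a with
  | empty =>
    cases h
    exact .empty _
  | root k _ ih =>
    cases h with
    | empty => exact .empty _
    | root k₀ h₀ => exact .root (fun c i => k c (k₀ c i)) fun c i => ih c (k₀ c i) (h₀ c i)
    | sub c j h => exact .sub c (k c j) (ih c j h)
  | sub c j _ ih => exact .sub c j (ih h)

theorem Le.of_isChild {c : Bool} {t T : Code} (h : IsChild c t T) : Le t T := by
  cases T with
  | empty => exact h.elim
  | node f =>
    obtain ⟨i, rfl⟩ := h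
    exact .sub c i (.refl _)

theorem wellFounded_isChild : WellFounded fun t T => ∃ c, IsChild c t T := by
  refine ⟨fun T => ?_⟩
  induction T with
  | empty => exact ⟨_, fun _ h => h.choose_spec.elim⟩
  | node f ih =>
    refine ⟨_, ?_⟩
    rintro _ ⟨c, i, rfl⟩
    exact ih c i

theorem wellQuasiOrdered_le : WellQuasiOrdered Le := by
  refine exists_lt_of_children (fun _ _ _ => Le.trans) wellFounded_isChild
    (fun _ _ _ => Le.of_isChild) fun T T' h => ?_
  cases T with
  | empty => exact .empty _
  | node f =>
    cases T' with
    | empty => exact (h true _ ⟨0, rfl⟩).choose_spec.1.elim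
    | node f' =>
      have h' : ∀ c i, ∃ j, Le (f c i) (f' c j) := by
        intro c i
        obtain ⟨_, ⟨j, rfl⟩, hle⟩ := h c _ ⟨i, rfl⟩
        exact ⟨j, hle⟩
      choose k hk using h'
      exact .root k hk

instance : IsPreorder Code Le where
  refl := Le.refl
  trans _ _ _ := Le.trans

/-- If all codes on one side are empty on both nodes, then an inequality of the nodes comes from
inequalities between their children. -/
theorem Le.exists_of_empty {f f' : Bool → ℕ → Code} (h : Le (node f) (node f')) {c : Bool}
    (hf : ∀ i, f c i = .empty) (hf' : ∀ i, f' c i = .empty) (d : Bool) (i : ℕ) :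
    ∃ j, Le (f d i) (f' d j) := by
  by_cases hd : d = c
  · rw [hd, hf]
    exact ⟨0, .empty _⟩
  · cases h with
    | root k h => exact ⟨_, h d i⟩
    | sub c' j h =>
      by_cases hc : c' = c
      · rw [hc, hf'] at h
        cases h
      · obtain rfl : c' = d := by
          cases c <;> cases c' <;> cases d <;> simp_all
        exact ⟨j, (Le.sub _ i (.refl _)).trans h⟩

/-- Every code of the sequence is dominated by infinitely many others. -/
def Regular (s : ℕ → Code) : Prop := ∀ i, ∃ᶠ m in atTop, Le (s i) (s m)

theorem exists_regular_shift (s : ℕ → Code) : ∃ N, Regular fun i => s (N + i) := by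
  have : ∃ N, ∀ i ≥ N, ∃ᶠ m in atTop, Le (s i) (s m) := by
    by_contra! h
    obtain ⟨φ, hφ, hb⟩ := extraction_of_frequently_atTop
      (frequently_atTop.2 fun n => (h n).imp fun i hi => ⟨hi.1, not_frequently.2 hi.2⟩ :
        ∃ᶠ i in atTop, ¬ ∃ᶠ m in atTop, Le (s i) (s m))
    obtain ⟨g, hg⟩ := wellQuasiOrdered_le.exists_monotone_subseq (f := s ∘ φ)
    refine hb (g 0) (frequently_atTop.2 fun n => ⟨φ (g n), ?_, hg 0 n (Nat.zero_le n)⟩)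
    exact (hφ.comp g.strictMono).id_le n
  obtain ⟨N, hN⟩ := this
  refine ⟨N, fun i => frequently_atTop.2 fun n => ?_⟩
  obtain ⟨m, hm, hle⟩ := frequently_atTop.1 (hN (N + i) (Nat.le_add_right _ _)) (N + n)
  refine ⟨m - N, by omega, ?_⟩
  rwa [← show N + (m - N) = m by omega] at hle

end Code

/-! ### Realizing codes in sets of reals -/

/-- The open interval `(y, x)` is divided by an increasing sequence of points outside `V`
converging to `x` into pieces of which the `i`-th satisfies `N i`. -/
def Ladder (V : Set ℝ) (N : ℕ → ℝ → ℝ → Prop) (y x : ℝ) : Prop :=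
  ∃ u : ℕ → ℝ, u 0 = y ∧ StrictMono u ∧ Tendsto u atTop (nhds x) ∧ (∀ i, u i ∉ V) ∧
    ∀ i, N i (u i) (u (i + 1))

/-- The trace of `V` on the open interval is described by the code. -/
def Code.At (V : Set ℝ) : Code → ℝ → ℝ → Prop
  | .empty, y, z => V ∩ Ioo y z = ∅
  | .node f, y, z => ∃ x, x ∈ V ∧ (∀ c, Regular (f c)) ∧
      Ladder V (fun i a b => At V (f true i) a b) y x ∧
      Ladder (-V) (fun i a b => At V (f false i) (-b) (-a)) (-z) (-x)

/-- The trace of `V` on the open interval `(y, z)` is described by the code `node f`, with `x` as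
the corresponding point. -/
def Code.NodeAt (V : Set ℝ) (f : Bool → ℕ → Code) (y x z : ℝ) : Prop :=
  x ∈ V ∧ (∀ c, Regular (f c)) ∧ Ladder V (fun i => Code.At V (f true i)) y x ∧
    Ladder (-V) (fun i a b => Code.At V (f false i) (-b) (-a)) (-z) (-x)

theorem Code.at_node {V : Set ℝ} {f : Bool → ℕ → Code} {y z : ℝ} :
    Code.At V (.node f) y z ↔ ∃ x, Code.NodeAt V f y x z := Iff.rfl

theorem Ladder.lt {V : Set ℝ} {N : ℕ → ℝ → ℝ → Prop} {y x : ℝ} (h : Ladder V N y x) : y < x := by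
  obtain ⟨u, rfl, hu, hx, -⟩ := h
  exact (hu Nat.zero_lt_one).trans_le (hu.monotone.ge_of_tendsto hx 1)

/-! ### Embeddings of coded sets -/

/-- `g` is strictly increasing and continuous on `S`, and maps `S` into `S'`. -/
def IsEmb (g : ℝ → ℝ) (S S' : Set ℝ) : Prop :=
  StrictMonoOn g S ∧ MapsTo g S S' ∧ ContinuousOn g S

theorem IsEmb.mono {g : ℝ → ℝ} {S T S' T' : Set ℝ} (h : IsEmb g T S') (hS : S ⊆ T)
    (hS' : S' ⊆ T') : IsEmb g S T' :=
  ⟨h.1.mono hS, (h.2.1.mono_left hS).mono_right hS', h.2.2.mono hS⟩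

theorem isEmb_empty (g : ℝ → ℝ) (S' : Set ℝ) : IsEmb g ∅ S' :=
  ⟨by simp [StrictMonoOn], mapsTo_empty _ _, continuousOn_empty _⟩

theorem IsEmb.neg {g : ℝ → ℝ} {S S' : Set ℝ} (h : IsEmb g S S') :
    IsEmb (fun p => -g (-p)) (-S) (-S') := by
  refine ⟨fun p hp q hq hpq => neg_lt_neg (h.1 hq hp (neg_lt_neg hpq)), fun p hp => ?_, ?_⟩
  · simpa using h.2.1 hp
  · exact (h.2.2.comp continuous_neg.continuousOn fun p hp => hp).neg

theorem ContinuousOn.of_Iic_Ici {g : ℝ → ℝ} {S : Set ℝ} {w : ℝ}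
    (h₁ : ContinuousOn g (S ∩ Iic w)) (h₂ : ContinuousOn g (S ∩ Ici w)) : ContinuousOn g S := by
  intro p hp
  rw [show S = S ∩ Iic w ∪ S ∩ Ici w by rw [← inter_union_distrib_left, Iic_union_Ici, inter_univ]]
  refine ContinuousWithinAt.union ?_ ?_
  · rcases le_or_gt p w with h | h
    · exact h₁ p ⟨hp, h⟩
    · exact continuousWithinAt_of_notMem_closure fun hc =>
        not_le.2 h (closure_minimal inter_subset_right isClosed_Iic hc)
  · rcases le_or_gt w p with h | h
    · exact h₂ p ⟨hp, h⟩
    · exact continuousWithinAt_of_notMem_closure fun hc =>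
        not_le.2 h (closure_minimal inter_subset_right isClosed_Ici hc)

/-- Two embeddings of sets lying on different sides of `w` have a common extension. -/
theorem exists_isEmb_union {g₁ g₂ : ℝ → ℝ} {S₁ S₂ S₁' S₂' : Set ℝ} {w w' : ℝ}
    (h₁ : IsEmb g₁ S₁ S₁') (h₂ : IsEmb g₂ S₂ S₂') (hS₁ : S₁ ⊆ Iic w) (hS₂ : S₂ ⊆ Ici w)
    (hS₁' : S₁' ⊆ Iic w') (hS₂' : S₂' ⊆ Ici w')
    (hw : (w ∉ S₁ ∧ w ∉ S₂ ∧ w' ∉ S₁') ∨ (w ∈ S₁ ∧ w ∈ S₂ ∧ g₁ w = w' ∧ g₂ w = w')) :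
    ∃ g, IsEmb g (S₁ ∪ S₂) (S₁' ∪ S₂') ∧ EqOn g g₁ S₁ ∧ EqOn g g₂ S₂ := by
  classical
  let g : ℝ → ℝ := fun p => if p ≤ w then g₁ p else g₂ p
  have e₁ : EqOn g g₁ S₁ := fun p hp => if_pos (hS₁ hp)
  have e₂ : EqOn g g₂ S₂ := by
    intro p hp
    rcases eq_or_lt_of_le (show w ≤ p from hS₂ hp) with rfl | h
    · rcases hw with hw | hw
      · exact absurd hp hw.2.1
      · exact (if_pos le_rfl).trans (hw.2.2.1.trans hw.2.2.2.symm)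
    · exact if_neg (not_le.2 h)
  have hd : (S₁ ∪ S₂) ∩ Iic w ⊆ S₁ := by
    rintro p ⟨hp | hp, hpw⟩
    · exact hp
    · obtain rfl : p = w := le_antisymm hpw (hS₂ hp)
      rcases hw with hw | hw
      exacts [absurd hp hw.2.1, hw.1]
  have hu : (S₁ ∪ S₂) ∩ Ici w ⊆ S₂ := by
    rintro p ⟨hp | hp, hpw⟩
    · obtain rfl : p = w := le_antisymm (hS₁ hp) hpw
      rcases hw with hw | hw
      exacts [absurd hp hw.1, hw.2.1]
    · exact hp
  refine ⟨g, ⟨?_, ?_, ?_⟩, e₁, e₂⟩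
  · intro p hp q hq hpq
    by_cases hqw : q ≤ w
    · have hp1 := hd ⟨hp, hpq.le.trans hqw⟩
      have hq1 := hd ⟨hq, hqw⟩
      rw [e₁ hp1, e₁ hq1]
      exact h₁.1 hp1 hq1 hpq
    by_cases hpw : w ≤ p
    · have hp2 := hu ⟨hp, hpw⟩
      have hq2 := hu ⟨hq, hpw.trans hpq.le⟩
      rw [e₂ hp2, e₂ hq2]
      exact h₂.1 hp2 hq2 hpq
    have hp1 := hd ⟨hp, (not_le.1 hpw).le⟩
    have hq2 := hu ⟨hq, (not_le.1 hqw).le⟩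
    rw [e₁ hp1, e₂ hq2]
    have h3 : w' ≤ g₂ q := hS₂' (h₂.2.1 hq2)
    rcases hw with hw | hw
    · have h4 : g₁ p ≤ w' := hS₁' (h₁.2.1 hp1)
      exact (lt_of_le_of_ne h4 fun h => hw.2.2 (h ▸ h₁.2.1 hp1)).trans_le h3
    · exact (h₁.1 hp1 hw.1 (not_le.1 hpw)).trans_le (hw.2.2.1.trans_le h3)
  · rintro p (hp | hp)
    · exact .inl (e₁ hp ▸ h₁.2.1 hp)
    · exact .inr (e₂ hp ▸ h₂.2.1 hp)
  · exact .of_Iic_Ici ((h₁.2.2.mono hd).congr (e₁.mono hd)) ((h₂.2.2.mono hu).congr (e₂.mono hu))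

theorem Ladder.exists_isEmb {V V' : Set ℝ} {N N' : ℕ → ℝ → ℝ → Prop} {y x y' x' : ℝ}
    (h : Ladder V N y x) (h' : Ladder V' N' y' x') (hx' : x' ∈ V') {P : ℕ → ℕ → Prop}
    (hP : ∀ i, ∃ᶠ m in atTop, P i m)
    (hN : ∀ i m a b a' b', P i m → N i a b → N' m a' b' →
      ∃ g, IsEmb g (V ∩ Ioo a b) (V' ∩ Ioo a' b')) :
    ∃ g, IsEmb g (V ∩ Ioc y x) (V' ∩ Ioc y' x') ∧ g x = x' := by
  classical
  obtain ⟨u, rfl, hu, hux, huV, huN⟩ := h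
  obtain ⟨u', rfl, hu', hux', huV', huN'⟩ := h'
  obtain ⟨φ, hφ, hPφ⟩ := extraction_forall_of_frequently hP
  choose G hG using fun i => hN i (φ i) _ _ _ _ (hPφ i) (huN i) (huN' (φ i))
  have hidx : ∀ p, ∃ i, p ∈ V ∩ Ioo (u 0) x → p ∈ Ioo (u i) (u (i + 1)) := by
    intro p
    by_cases hp : p ∈ V ∩ Ioo (u 0) x
    · have hex : ∃ n, p < u n := (hux.eventually (lt_mem_nhds hp.2.2)).exists
      have hmin := fun {m} => Nat.find_min (m := m) hex
      have hlt := Nat.find_spec hex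
      rcases hn : Nat.find hex with - | j
      · rw [hn] at hlt
        exact absurd hp.2.1 (not_lt.2 hlt.le)
      · rw [hn] at hlt hmin
        refine ⟨j, fun _ => ⟨lt_of_le_of_ne (not_lt.1 (hmin j.lt_succ_self)) ?_, hlt⟩⟩
        exact fun h => huV j (h ▸ hp.1)
    · exact ⟨0, fun h => absurd h hp⟩
  choose idx hidx using hidx
  have hle : ∀ {p i}, p ∈ V ∩ Ioo (u 0) x → p < u (i + 1) → idx p ≤ i := fun {p i} hp hpi =>
    Nat.lt_succ_iff.1 (hu.lt_iff_lt.1 ((hidx p hp).1.trans hpi))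
  have hge : ∀ {p i}, p ∈ V ∩ Ioo (u 0) x → u i < p → i ≤ idx p := fun {p i} hp hpi =>
    Nat.lt_succ_iff.1 (hu.lt_iff_lt.1 (hpi.trans (hidx p hp).2))
  have hGm : ∀ p ∈ V ∩ Ioo (u 0) x,
      G (idx p) p ∈ V' ∩ Ioo (u' (φ (idx p))) (u' (φ (idx p) + 1)) := fun p hp =>
    (hG (idx p)).2.1 ⟨hp.1, hidx p hp⟩
  have hux'lt : ∀ n, u' n < x' := fun n =>
    (hu' n.lt_succ_self).trans_le (hu'.monotone.ge_of_tendsto hux' _)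
  let g : ℝ → ℝ := fun p => if p < x then G (idx p) p else x'
  have hgx : g x = x' := if_neg (lt_irrefl x)
  have hg : ∀ {p}, p ∈ V ∩ Ioo (u 0) x → g p = G (idx p) p := fun hp => if_pos hp.2.2
  have hgle : ∀ p ∈ V ∩ Ioc (u 0) x, g p ≤ x' := by
    rintro p ⟨hp, hp1, hp2⟩
    rcases hp2.lt_or_eq with h | rfl
    · rw [hg ⟨hp, hp1, h⟩]
      exact ((hGm p ⟨hp, hp1, h⟩).2.2.trans (hux'lt _)).le
    · exact hgx.le
  refine ⟨g, ⟨?_, ?_, ?_⟩, hgx⟩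
  · rintro p ⟨hp, hp1, -⟩ q ⟨hq, hq1, hq2⟩ hpq
    have hp' : p ∈ V ∩ Ioo (u 0) x := ⟨hp, hp1, hpq.trans_le hq2⟩
    rw [hg hp']
    rcases hq2.lt_or_eq with hqx | rfl
    · have hq' : q ∈ V ∩ Ioo (u 0) x := ⟨hq, hq1, hqx⟩
      rw [hg hq']
      rcases (hle hp' (hpq.trans (hidx q hq').2)).eq_or_lt with e | l
      · rw [e]
        exact (hG (idx q)).1 ⟨hp, e ▸ hidx p hp'⟩ ⟨hq, hidx q hq'⟩ hpq
      · exact ((hGm p hp').2.2.trans_le (hu'.monotone (hφ l))).trans (hGm q hq').2.1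
    · rw [hgx]
      exact (hGm p hp').2.2.trans (hux'lt _)
  · rintro p ⟨hp, hp1, hp2⟩
    rcases hp2.lt_or_eq with hpx | rfl
    · have hp' : p ∈ V ∩ Ioo (u 0) x := ⟨hp, hp1, hpx⟩
      rw [hg hp']
      have := hGm p hp'
      exact ⟨this.1, (hu'.monotone (Nat.zero_le _)).trans_lt this.2.1,
        (this.2.2.trans (hux'lt _)).le⟩
    · rw [hgx]
      exact ⟨hx', hux'lt 0, le_rfl⟩
  · rintro p ⟨hp, hp1, hp2⟩
    rcases hp2.lt_or_eq with hpx | rfl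
    · have hp' : p ∈ V ∩ Ioo (u 0) x := ⟨hp, hp1, hpx⟩
      have hi := hidx p hp'
      have hiS : Ioo (u (idx p)) (u (idx p + 1)) ⊆ Ioo (u 0) x := Ioo_subset_Ioo
        (hu.monotone (Nat.zero_le _)) (hu.monotone.ge_of_tendsto hux _)
      have hn : Ioo (u (idx p)) (u (idx p + 1)) ∈ nhds p := Ioo_mem_nhds hi.1 hi.2
      rw [← continuousWithinAt_inter hn]
      have heq : EqOn g (G (idx p)) (V ∩ Ioo (u (idx p)) (u (idx p + 1))) := by
        intro q hq
        have hq' : q ∈ V ∩ Ioo (u 0) x := ⟨hq.1, hiS hq.2⟩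
        rw [hg hq', le_antisymm (hle hq' hq.2.2) (hge hq' hq.2.1)]
      have hsub : V ∩ Ioc (u 0) x ∩ Ioo (u (idx p)) (u (idx p + 1)) ⊆
          V ∩ Ioo (u (idx p)) (u (idx p + 1)) := inter_subset_inter_left _ inter_subset_left
      exact (((hG (idx p)).2.2 p ⟨hp, hi⟩).congr heq (heq ⟨hp, hi⟩)).mono hsub
    · rw [ContinuousWithinAt, hgx]
      refine tendsto_order.2 ⟨fun a ha => ?_, fun a ha => ?_⟩
      · obtain ⟨n, hn⟩ := (hux'.eventually (lt_mem_nhds ha)).exists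
        have hpn : u n < p := (hu n.lt_succ_self).trans_le (hu.monotone.ge_of_tendsto hux _)
        filter_upwards [self_mem_nhdsWithin, mem_nhdsWithin_of_mem_nhds (lt_mem_nhds hpn)]
          with q hq hnq
        rcases hq.2.2.lt_or_eq with hqp | rfl
        · have hq' : q ∈ V ∩ Ioo (u 0) p := ⟨hq.1, hq.2.1, hqp⟩
          rw [hg hq']
          exact hn.trans_le ((hu'.monotone ((hφ.id_le n).trans
            (hφ.monotone (hge hq' hnq)))).trans (hGm q hq').2.1.le)
        · exact ha.trans_eq hgx.symm
      · filter_upwards [self_mem_nhdsWithin] with q hq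
        exact (hgle q hq).trans_lt ha

/-- The code `t` embeds into the code `t'`, whatever sets realize them. -/
def Code.Embeds (t t' : Code) : Prop :=
  ∀ {V V' : Set ℝ} {a b a' b' : ℝ}, t.At V a b → t'.At V' a' b' →
    ∃ g, IsEmb g (V ∩ Ioo a b) (V' ∩ Ioo a' b')

theorem Code.NodeAt.exists_isEmb {V V' : Set ℝ} {f f' : Bool → ℕ → Code} {y x z y' x' z' : ℝ}
    (h : NodeAt V f y x z) (h' : NodeAt V' f' y' x' z')
    (hf : ∀ c i t', Le (f c i) t' → (f c i).Embeds t') (hff' : ∀ c i, ∃ j, Le (f c i) (f' c j)) :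
    ∃ g, IsEmb g (V ∩ Ioo y z) (V' ∩ Ioo y' z') ∧ g x = x' := by
  obtain ⟨hx, -, hl, hr⟩ := h
  obtain ⟨hx', hreg, hl', hr'⟩ := h'
  have hP : ∀ c i, ∃ᶠ m in atTop, Le (f c i) (f' c m) := fun c i => by
    obtain ⟨j, hj⟩ := hff' c i
    exact (hreg c j).mono fun m hm => hj.trans hm
  obtain ⟨g₁, hg₁, e₁⟩ := hl.exists_isEmb hl' hx' (hP true)
    fun i m a b a' b' hle ha hb => hf true i _ hle ha hb
  obtain ⟨g₂, hg₂, e₂⟩ := hr.exists_isEmb hr' (by simpa using hx') (hP false)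
    fun i m a b a' b' hle ha hb => by
      obtain ⟨g, hg⟩ := hf false i _ hle ha hb
      have hn := hg.neg
      simp only [inter_neg, neg_Ioo, neg_neg] at hn
      exact ⟨_, hn⟩
  have hg₂' := hg₂.neg
  simp only [inter_neg, neg_Ioc, neg_neg] at hg₂'
  obtain ⟨g, hg, e, -⟩ := exists_isEmb_union (w := x) (w' := x') hg₁ hg₂'
    (fun p hp => hp.2.2) (fun p hp => hp.2.1) (fun p hp => hp.2.2) (fun p hp => hp.2.1)
    (.inr ⟨⟨hx, hl.lt, le_rfl⟩, ⟨hx, le_rfl, neg_lt_neg_iff.1 hr.lt⟩, e₁, by simp [e₂]⟩)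
  simp only [← inter_union_distrib_left, Ioc_union_Ico_eq_Ioo hl.lt (neg_lt_neg_iff.1 hr.lt),
    Ioc_union_Ico_eq_Ioo hl'.lt (neg_lt_neg_iff.1 hr'.lt)] at hg
  exact ⟨g, hg, (e ⟨hx, hl.lt, le_rfl⟩).trans e₁⟩

theorem Code.Le.embeds {t t' : Code} (h : Le t t') : t.Embeds t' := by
  induction t generalizing t' with
  | empty =>
    intro V V' a b a' b' ha _
    rw [show V ∩ Ioo a b = ∅ from ha]
    exact ⟨id, isEmb_empty _ _⟩
  | node f ih =>
    generalize hT : node f = T at h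
    induction h with
    | empty => cases hT
    | root k h =>
      cases hT
      rintro V V' a b a' b' ⟨x, ha⟩ ⟨x', hb⟩
      obtain ⟨g, hg, -⟩ := NodeAt.exists_isEmb ha hb (fun c i t' h => ih c i h)
        fun c i => ⟨_, h c i⟩
      exact ⟨g, hg⟩
    | @sub t f' c j h ih' =>
      rintro V V' a b a' b' ha ⟨x, hx, -, hl, hr⟩
      have hlt := hl.lt
      have hrt := neg_lt_neg_iff.1 hr.lt
      cases c with
      | true =>
        obtain ⟨u, rfl, hu, hux, -, hN⟩ := hl
        obtain ⟨g, hg⟩ := ih' hT ha (hN j)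
        refine ⟨g, hg.mono Subset.rfl (inter_subset_inter_right _ (Ioo_subset_Ioo
          (hu.monotone (Nat.zero_le _)) ((hu.monotone.ge_of_tendsto hux _).trans hrt.le)))⟩
      | false =>
        obtain ⟨u, hu0, hu, hux, -, hN⟩ := hr
        obtain ⟨g, hg⟩ := ih' hT ha (hN j)
        refine ⟨g, hg.mono Subset.rfl (inter_subset_inter_right _ (Ioo_subset_Ioo ?_ ?_))⟩
        · have := hu.monotone.ge_of_tendsto hux (j + 1)
          linarith
        · have := hu.monotone (Nat.zero_le j)
          linarith

/-- The trace of `V` on the open interval is described by the list of codes. -/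
def ListAt (V : Set ℝ) : List Code → ℝ → ℝ → Prop
  | [], a, b => V ∩ Ioo a b = ∅
  | t :: l, a, b => ∃ w, w ∉ V ∧ a ≤ w ∧ w ≤ b ∧ t.At V a w ∧ ListAt V l w b

theorem inter_Ioo_union {V : Set ℝ} {a w b : ℝ} (hw : w ∉ V) (haw : a ≤ w) (hwb : w ≤ b) :
    V ∩ Ioo a w ∪ V ∩ Ioo w b = V ∩ Ioo a b := by
  rw [← inter_union_distrib_left]
  ext p
  simp only [mem_inter_iff, mem_union, mem_Ioo]
  constructor
  · rintro ⟨hp, h | h⟩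
    exacts [⟨hp, h.1, h.2.trans_le hwb⟩, ⟨hp, haw.trans_lt h.1, h.2⟩]
  · rintro ⟨hp, h1, h2⟩
    rcases lt_trichotomy p w with h | rfl | h
    exacts [⟨hp, .inl ⟨h1, h⟩⟩, absurd hp hw, ⟨hp, .inr ⟨h, h2⟩⟩]

/-- Embeddings of the traces on two adjacent intervals have a common extension. -/
theorem exists_isEmb_Ioo {g₁ g₂ : ℝ → ℝ} {V V' : Set ℝ} {a w b a' w' b' : ℝ}
    (h₁ : IsEmb g₁ (V ∩ Ioo a w) (V' ∩ Ioo a' w')) (h₂ : IsEmb g₂ (V ∩ Ioo w b) (V' ∩ Ioo w' b'))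
    (hw : w ∉ V) (haw : a ≤ w) (hwb : w ≤ b) (hw' : w' ∉ V') (haw' : a' ≤ w') (hwb' : w' ≤ b') :
    ∃ g, IsEmb g (V ∩ Ioo a b) (V' ∩ Ioo a' b') ∧ EqOn g g₁ (V ∩ Ioo a w) ∧
      EqOn g g₂ (V ∩ Ioo w b) := by
  rw [← inter_Ioo_union hw haw hwb, ← inter_Ioo_union hw' haw' hwb']
  exact exists_isEmb_union h₁ h₂ (fun p hp => hp.2.2.le) (fun p hp => hp.2.1.le)
    (fun p hp => hp.2.2.le) (fun p hp => hp.2.1.le)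
    (.inl ⟨fun h => hw h.1, fun h => hw h.1, fun h => hw' h.1⟩)

theorem ListAt.exists_isEmb {V V' : Set ℝ} {l l' : List Code}
    (h : List.SublistForall₂ Code.Le l l') {a b a' b' : ℝ} (hl : ListAt V l a b)
    (hl' : ListAt V' l' a' b') : ∃ g, IsEmb g (V ∩ Ioo a b) (V' ∩ Ioo a' b') := by
  induction h generalizing a a' with
  | nil =>
    rw [show V ∩ Ioo a b = ∅ from hl]
    exact ⟨id, isEmb_empty _ _⟩
  | cons hle _ ih =>
    obtain ⟨w, hw, haw, hwb, ht, hl⟩ := hl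
    obtain ⟨w', hw', haw', hwb', ht', hl'⟩ := hl'
    obtain ⟨g₁, hg₁⟩ := hle.embeds ht ht'
    obtain ⟨g₂, hg₂⟩ := ih hl hl'
    obtain ⟨g, hg, -⟩ := exists_isEmb_Ioo hg₁ hg₂ hw haw hwb hw' haw' hwb'
    exact ⟨g, hg⟩
  | cons_right _ ih =>
    obtain ⟨w', hw', haw', hwb', ht', hl'⟩ := hl'
    obtain ⟨g, hg⟩ := ih hl hl'
    exact ⟨g, hg.mono Subset.rfl (inter_subset_inter_right _ (Ioo_subset_Ioo haw' le_rfl))⟩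

/-! ### Existence of codes -/

/-- There is a chain of `n` consecutive `R`-steps from `x` to `y`. -/
def StepPath {α : Type*} (R : α → α → Prop) : ℕ → α → α → Prop
  | 0, x, y => x = y
  | n + 1, x, y => ∃ z, R x z ∧ StepPath R n z y

theorem exists_stepPath_of_transGen {α : Type*} {R : α → α → Prop} {x y : α}
    (h : Relation.TransGen R x y) : ∃ n, StepPath R (n + 1) x y := by
  induction h using Relation.TransGen.head_induction_on with
  | single h => exact ⟨0, _, h, rfl⟩
  | head h _ ih => exact ⟨ih.choose + 1, _, h, ih.choose_spec⟩

/-- Consecutive finite chains can be concatenated into an infinite one. -/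
theorem exists_seq_of_transGen {α : Type*} {R : α → α → Prop} {w : ℕ → α}
    (h : ∀ k, Relation.TransGen R (w k) (w (k + 1))) :
    ∃ u : ℕ → α, u 0 = w 0 ∧ (∀ i, R (u i) (u (i + 1))) ∧ ∀ k, ∃ i, u i = w k := by
  choose len hlen using fun k => exists_stepPath_of_transGen (h k)
  let T := {s : α × ℕ × ℕ // StepPath R (s.2.2 + 1) s.1 (w s.2.1)}
  have hnext : ∀ s : T, ∃ s' : T, R s.1.1 s'.1.1 ∧
      (s.1.2.2 = 0 → s'.1 = (w s.1.2.1, s.1.2.1 + 1, len s.1.2.1)) ∧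
      ∀ n, s.1.2.2 = n + 1 → s'.1.2 = (s.1.2.1, n) := by
    rintro ⟨⟨x, k, n⟩, z, hxz, hz⟩
    cases n with
    | zero =>
      obtain rfl : z = w k := hz
      exact ⟨⟨(w k, k + 1, len k), hlen k⟩, hxz, fun _ => rfl, fun _ h => by cases h⟩
    | succ n => exact ⟨⟨(z, k, n), hz⟩, hxz, fun h => (by cases h), fun m h => (by cases h; rfl)⟩
  choose next hR hzero hsucc using hnext
  let s : ℕ → T := fun n => next^[n] ⟨(w 0, 1, len 0), hlen 0⟩
  have hs : ∀ n, s (n + 1) = next (s n) := fun n => Function.iterate_succ_apply' _ _ _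
  have hreach : ∀ n i k, (s i).1.2 = (k, n) → ∃ j, (s j).1 = (w k, k + 1, len k) := by
    intro n
    induction n with
    | zero =>
      intro i k hi
      refine ⟨i + 1, ?_⟩
      rw [hs, hzero _ (by rw [hi]), hi]
    | succ n ih =>
      intro i k hi
      refine ih (i + 1) k ?_
      rw [hs, hsucc _ n (by rw [hi]), hi]
  have hvisit : ∀ k, ∃ j, (s j).1 = (w k, k + 1, len k) := by
    intro k
    induction k with
    | zero => exact ⟨0, rfl⟩
    | succ k ih =>
      obtain ⟨j, hj⟩ := ih
      exact hreach (len k) j (k + 1) (by rw [hj])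
  refine ⟨fun n => (s n).1.1, rfl, fun i => ?_, fun k => ?_⟩
  · exact (congrArg (fun a : T => R (s i).1.1 a.1.1) (hs i)).mpr (hR (s i))
  · obtain ⟨j, hj⟩ := hvisit k
    exact ⟨j, congrArg Prod.fst hj⟩

/-- The points `a < b` outside `V` bound an interval described by a single code. -/
def CodeStep (V : Set ℝ) (A : Code → ℝ → ℝ → Prop) (a b : ℝ) : Prop :=
  a < b ∧ a ∉ V ∧ b ∉ V ∧ ∃ t, A t a b

theorem transGen_codeStep_neg {V : Set ℝ} {A : Code → ℝ → ℝ → Prop} {c d : ℝ}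
    (h : Relation.TransGen (CodeStep V A) c d) :
    Relation.TransGen (CodeStep (-V) fun t a b => A t (-b) (-a)) (-d) (-c) := by
  have key : ∀ {a b}, CodeStep V A a b → CodeStep (-V) (fun t a b => A t (-b) (-a)) (-b) (-a) := by
    rintro a b ⟨hab, ha, hb, t, ht⟩
    exact ⟨neg_lt_neg hab, by simpa using hb, by simpa using ha, t, by simpa using ht⟩
  induction h with
  | single h => exact .single (key h)
  | tail _ h ih => exact .head (key h) ih

theorem exists_ladder {V : Set ℝ} (hV : V.Countable) {A : Code → ℝ → ℝ → Prop} {a b : ℝ}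
    (hab : a < b) (ha : a ∉ V)
    (h : ∀ c d, c ∉ V → d ∉ V → a ≤ c → c < d → d < b → Relation.TransGen (CodeStep V A) c d) :
    ∃ w, w ∉ V ∧ a < w ∧ w < b ∧ Relation.TransGen (CodeStep V A) a w ∧
      ∃ f, Code.Regular f ∧ Ladder V (fun i => A (f i)) w b := by
  obtain ⟨v, hv, hvm, hvb⟩ := (hV.dense_compl ℝ).exists_seq_strictMono_tendsto_of_lt hab
  obtain ⟨u, hu0, hu, huv⟩ := exists_seq_of_transGen fun k =>
    h (v k) (v (k + 1)) (hvm k).2 (hvm (k + 1)).2 (hvm k).1.1.le (hv k.lt_succ_self)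
      (hvm (k + 1)).1.2
  have hum : StrictMono u := strictMono_nat_of_lt_succ fun i => (hu i).1
  choose φ hφ using huv
  have hφm : StrictMono φ := fun i j hij => hum.lt_iff_lt.1 (by simpa only [hφ] using hv hij)
  have hub : Tendsto u atTop (nhds b) := by
    rw [tendsto_iff_tendsto_subseq_of_monotone hum.monotone hφm.tendsto_atTop]
    exact hvb.congr fun n => (hφ n).symm
  choose t ht using fun i => (hu i).2.2.2
  obtain ⟨N, hN⟩ := Code.exists_regular_shift t
  have hlt : u 0 ≤ u N := hum.monotone (Nat.zero_le N)
  have haN : a < u N := (hu0 ▸ (hvm 0).1.1).trans_le hlt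
  have hNb : u N < b := (hum N.lt_succ_self).trans_le (hum.monotone.ge_of_tendsto hub _)
  exact ⟨u N, (hu N).2.1, haN, hNb, h a (u N) ha (hu N).2.1 le_rfl haN hNb, _, hN,
    fun i => u (N + i), rfl, hum.comp (fun i j hij => Nat.add_lt_add_left hij N),
    hub.comp (tendsto_add_atTop_nat N |>.congr fun i => add_comm _ _), fun i => (hu _).2.1,
    fun i => ht (N + i)⟩

/-- The points `c` and `d` outside `V` bound an interval described by finitely many codes. -/
def Coded (V : Set ℝ) : ℝ → ℝ → Prop := Relation.TransGen (CodeStep V fun t => t.At V)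

theorem exists_nodeAt {V : Set ℝ} (hV : V.Countable) {a b d : ℝ} (hab : a < b) (hbd : b < d)
    (ha : a ∉ V) (hb : b ∈ V) (hd : d ∉ V)
    (hl : ∀ p q, p ∉ V → q ∉ V → a ≤ p → p < q → q < b → Coded V p q)
    (hr : ∀ p q, p ∉ V → q ∉ V → b < p → p < q → q ≤ d → Coded V p q) :
    ∃ f y z, y ∉ V ∧ z ∉ V ∧ a < y ∧ y < b ∧ b < z ∧ z < d ∧ Coded V a y ∧ Coded V z d ∧
      Code.NodeAt V f y b z := by
  obtain ⟨y, hyV, hay, hyb, hy, f₁, hf₁, hlad₁⟩ := exists_ladder hV hab ha hl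
  obtain ⟨z, hzV, hdz, hzb, hz, f₂, hf₂, hlad₂⟩ := exists_ladder (V := -V) (a := -d) (b := -b)
    (A := fun t p q => t.At V (-q) (-p)) (by simpa using hV.image Neg.neg) (neg_lt_neg hbd)
    (by simpa using hd) fun p q hp hq hdp hpq hqb => by
      simpa using transGen_codeStep_neg
        (hr (-q) (-p) hq hp (by linarith) (neg_lt_neg hpq) (by linarith))
  refine ⟨fun c => if c then f₁ else f₂, y, -z, hyV, hzV, hay, hyb, by linarith, by linarith,
    hy, ?_, hb, ?_, by simpa using hlad₁, by simpa using hlad₂⟩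
  · simpa [Coded] using transGen_codeStep_neg hz
  · rintro (- | -)
    exacts [hf₂, hf₁]

/-- `x` has a neighbourhood in which all intervals are described by finitely many codes. -/
def LocallyCoded (V : Set ℝ) (x : ℝ) : Prop :=
  ∃ ε > 0, ∀ p ∈ Metric.ball x ε, ∀ q ∈ Metric.ball x ε, p ∉ V → q ∉ V → p < q → Coded V p q

theorem isOpen_locallyCoded (V : Set ℝ) : IsOpen {x | LocallyCoded V x} := by
  refine Metric.isOpen_iff.2 fun x ⟨ε, hε, h⟩ => ⟨ε / 2, half_pos hε, fun y hy => ?_⟩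
  have : Metric.ball y (ε / 2) ⊆ Metric.ball x ε :=
    Metric.ball_subset_ball' (by linarith [Metric.mem_ball.1 hy])
  exact ⟨ε / 2, half_pos hε, fun p hp q hq => h p (this hp) q (this hq)⟩

theorem coded_of_locallyCoded {V : Set ℝ} (hV : V.Countable) {c d : ℝ} (hc : c ∉ V) (hd : d ∉ V)
    (hcd : c < d) (h : ∀ x ∈ Icc c d, LocallyCoded V x) : Coded V c d := by
  choose! ε hε hS using h
  obtain ⟨δ, hδ, hcov⟩ := lebesgue_number_lemma_of_metric (s := Icc c d)
    (c := fun x : Icc c d => Metric.ball (x : ℝ) (ε x)) isCompact_Icc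
    (fun _ => Metric.isOpen_ball)
    fun x hx => mem_iUnion.2 ⟨⟨x, hx⟩, Metric.mem_ball_self (hε x hx)⟩
  have hδS : ∀ p q, p ∈ Icc c d → p ∉ V → q ∉ V → p < q → q < p + δ → Coded V p q := by
    intro p q hp hpV hqV hpq hq
    obtain ⟨x, hx⟩ := hcov p hp
    refine hS x x.2 p (hx (Metric.mem_ball_self hδ)) q (hx ?_) hpV hqV hpq
    rw [Real.ball_eq_Ioo]
    constructor <;> linarith
  have key : ∀ n : ℕ, ∀ p, p ∈ Icc c d → p ∉ V → p < d → d - p < n * (δ / 2) → Coded V p d := by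
    intro n
    induction n with
    | zero =>
      intro p _ _ hpd hn
      simp at hn
      linarith
    | succ n ih =>
      intro p hp hpV hpd hn
      push_cast at hn
      by_cases hdp : d < p + δ
      · exact hδS p d hp hpV hd hpd hdp
      obtain ⟨r, hrV, hr₁, hr₂⟩ := (hV.dense_compl ℝ).exists_between
        (show p + δ / 2 < p + δ by linarith)
      exact (hδS p r hp hpV hrV (by linarith) hr₂).trans
        (ih r ⟨by linarith [hp.1], by linarith⟩ hrV (by linarith) (by linarith))
  obtain ⟨n, hn⟩ := exists_nat_gt ((d - c) / (δ / 2))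
  exact key n c (left_mem_Icc.2 hcd.le) hc hcd ((div_lt_iff₀ (half_pos hδ)).1 hn)

theorem locallyCoded_of_countable {V : Set ℝ} (hV : V.Countable) (hcl : IsClosed V) (x : ℝ) :
    LocallyCoded V x := by
  let E : Set ℝ := {x | ¬ LocallyCoded V x}
  have hEV : E ⊆ V := by
    intro x hx
    by_contra hxV
    obtain ⟨ε, hε, hball⟩ := Metric.isOpen_iff.1 hcl.isOpen_compl x hxV
    refine hx ⟨ε, hε, fun p hp q hq hpV hqV hpq => .single ⟨hpq, hpV, hqV, .empty, ?_⟩⟩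
    change V ∩ Ioo p q = ∅
    rw [← disjoint_iff_inter_eq_empty, disjoint_comm, ← subset_compl_iff_disjoint_right]
    refine Subset.trans ?_ hball
    rw [Real.ball_eq_Ioo] at hp hq ⊢
    exact Ioo_subset_Ioo hp.1.le hq.2.le
  have hE : Perfect E := by
    refine ⟨(isOpen_locallyCoded V).isClosed_compl, fun x hx => ?_⟩
    rw [accPt_iff_nhds]
    by_contra! hacc
    obtain ⟨U, hU, hUE⟩ := hacc
    obtain ⟨ε, hε, hball⟩ := Metric.mem_nhds_iff.1 hU
    have hlc : ∀ y ∈ Metric.ball x ε, y ≠ x → LocallyCoded V y := fun y hy hyx =>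
      by_contra fun hn => hyx (hUE y ⟨hball hy, hn⟩)
    have hS : ∀ p ∈ Metric.ball x ε, ∀ q ∈ Metric.ball x ε, p ∉ V → q ∉ V → p < q →
        x ∉ Icc p q → Coded V p q := by
      intro p hp q hq hpV hqV hpq hxpq
      refine coded_of_locallyCoded hV hpV hqV hpq fun y hy =>
        hlc y ?_ fun h => hxpq (h ▸ hy)
      rw [Real.ball_eq_Ioo] at hp hq ⊢
      exact ⟨hp.1.trans_le hy.1, hy.2.trans_lt hq.2⟩
    refine hx ⟨ε, hε, fun p hp q hq hpV hqV hpq => ?_⟩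
    by_cases hxpq : x ∈ Icc p q
    · have hpx : p < x := lt_of_le_of_ne hxpq.1 fun h => hpV (h ▸ hEV hx)
      have hxq : x < q := lt_of_le_of_ne hxpq.2 fun h => hqV (h ▸ hEV hx)
      have hIcc : ∀ r, p ≤ r → r ≤ q → r ∈ Metric.ball x ε := by
        intro r hpr hrq
        rw [Real.ball_eq_Ioo] at hp hq ⊢
        exact ⟨hp.1.trans_le hpr, hrq.trans_lt hq.2⟩
      obtain ⟨f, y, z, hy, hz, -, hyx, hxz, -, hSy, hSz, hnode⟩ := exists_nodeAt hV hpx hxq hpV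
        (hEV hx) hqV
        (fun r s hr hs hpr hrs hsx => hS r (hIcc r hpr (by linarith)) s
          (hIcc s (by linarith) (by linarith)) hr hs hrs fun h => not_lt.2 h.2 hsx)
        (fun r s hr hs hxr hrs hsq => hS r (hIcc r (by linarith) (by linarith)) s
          (hIcc s (by linarith) hsq) hr hs hrs fun h => not_lt.2 h.1 hxr)
      exact (hSy.tail ⟨hyx.trans hxz, hy, hz, .node f, x, hnode⟩).trans hSz
    · exact hS p hp q hq hpV hqV hpq hxpq
  by_contra hx
  obtain ⟨g, hg, -, hinj⟩ := hE.exists_nat_bool_injection ⟨x, hx⟩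
  have : Countable (ℕ → Bool) := by
    have := (hV.mono (hg.trans hEV)).to_subtype
    exact (rangeFactorization_injective.2 hinj).countable
  obtain ⟨F, hF⟩ := exists_injective_nat (ℕ → Bool)
  classical
  refine Function.cantor_injective (fun s : Set ℕ => F fun n => decide (n ∈ s)) fun s t hst => ?_
  ext n
  simpa using congrFun (hF hst) n

theorem coded_of_countable {V : Set ℝ} (hV : V.Countable) (hcl : IsClosed V) {c d : ℝ}
    (hc : c ∉ V) (hd : d ∉ V) (hcd : c < d) : Coded V c d :=
  coded_of_locallyCoded hV hc hd hcd fun x _ => locallyCoded_of_countable hV hcl x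

theorem Coded.exists_listAt {V : Set ℝ} {c d : ℝ} (h : Coded V c d) : ∃ l, ListAt V l c d := by
  induction h using Relation.TransGen.head_induction_on with
  | @single a h =>
    obtain ⟨hlt, -, hd, t, ht⟩ := h
    exact ⟨[t], d, hd, hlt.le, le_rfl, ht, by simp [ListAt]⟩
  | @head a b h hb ih =>
    obtain ⟨hlt, -, hbV, t, ht⟩ := h
    obtain ⟨l, hl⟩ := ih
    refine ⟨t :: l, b, hbV, hlt.le, ?_, ht, hl⟩
    clear hl ht hbV l t hlt
    induction hb with
    | single h => exact h.1.le
    | tail _ h ih => exact ih.trans h.1.le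

/-! ### Truth value embeddings -/

theorem geval_mem {ar : ℕ → ℕ} {V : Set ℝ} (hV : GodelSet V) (v : GValuation ar V)
    (e : ℕ → v.M) (φ : GFormula ar) : geval v e φ ∈ V := by
  have := v.ne
  have hbb : ∀ s ⊆ V, BddBelow s := fun s hs => bddBelow_Icc.mono (hs.trans hV.2.1)
  have hba : ∀ s ⊆ V, BddAbove s := fun s hs => bddAbove_Icc.mono (hs.trans hV.2.1)
  induction φ generalizing e with
  | bot => exact hV.2.2.1
  | atom p ts => exact v.interp_mem _ _
  | conj φ ψ h1 h2 =>
    simp only [geval]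
    rcases min_choice (geval v e φ) (geval v e ψ) with h | h <;> rw [h]
    exacts [h1 e, h2 e]
  | disj φ ψ h1 h2 =>
    simp only [geval]
    rcases max_choice (geval v e φ) (geval v e ψ) with h | h <;> rw [h]
    exacts [h1 e, h2 e]
  | imp φ ψ h1 h2 =>
    simp only [geval]
    split_ifs
    exacts [hV.2.2.2, h2 e]
  | all φ h =>
    have hs : (range fun m : v.M => geval v (consEnv m e) φ) ⊆ V := range_subset_iff.2 fun m => h _
    exact closure_minimal hs hV.1 (csInf_mem_closure (range_nonempty _) (hbb _ hs))
  | ex φ h =>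
    have hs : (range fun m : v.M => geval v (consEnv m e) φ) ⊆ V := range_subset_iff.2 fun m => h _
    exact closure_minimal hs hV.1 (csSup_mem_closure (range_nonempty _) (hba _ hs))

/-- Transport of a valuation along a map of truth value sets. -/
def GValuation.map {ar : ℕ → ℕ} {V W : Set ℝ} (v : GValuation ar V) (g : ℝ → ℝ)
    (hg : MapsTo g V W) : GValuation ar W :=
  ⟨v.M, v.ne, fun p t => g (v.interp p t), fun p t => hg (v.interp_mem p t)⟩

theorem geval_map {ar : ℕ → ℕ} {V W : Set ℝ} (hV : GodelSet V) (v : GValuation ar V)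
    {g : ℝ → ℝ} (hg : MapsTo g V W) (hmono : StrictMonoOn g V) (hcont : ContinuousOn g V)
    (h0 : g 0 = 0) (h1 : g 1 = 1) (e : ℕ → v.M) (φ : GFormula ar) :
    geval (v.map g hg) e φ = g (geval v e φ) := by
  have := v.ne
  have hbb : ∀ s ⊆ V, BddBelow s := fun s hs => bddBelow_Icc.mono (hs.trans hV.2.1)
  have hba : ∀ s ⊆ V, BddAbove s := fun s hs => bddAbove_Icc.mono (hs.trans hV.2.1)
  induction φ generalizing e with
  | bot => exact h0.symm
  | atom p ts => rfl
  | conj φ ψ ih ih' =>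
    simp only [geval, ih, ih']
    exact (hmono.monotoneOn.map_min (geval_mem hV v e φ) (geval_mem hV v e ψ)).symm
  | disj φ ψ ih ih' =>
    simp only [geval, ih, ih']
    exact (hmono.monotoneOn.map_max (geval_mem hV v e φ) (geval_mem hV v e ψ)).symm
  | imp φ ψ ih ih' =>
    simp only [geval, ih, ih', hmono.le_iff_le (geval_mem hV v e φ) (geval_mem hV v e ψ)]
    split_ifs
    exacts [h1.symm, rfl]
  | all φ ih =>
    have hs : (range fun m : v.M => geval v (consEnv m e) φ) ⊆ V :=
      range_subset_iff.2 fun m => geval_mem hV v _ φ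
    have hi := geval_mem hV v e φ.all
    simp only [geval] at hi ⊢
    rw [(hmono.monotoneOn.mono hs).map_csInf_of_continuousWithinAt
      ((hcont _ hi).mono hs) (range_nonempty _) (hbb _ hs), ← range_comp]
    exact congrArg sInf (congrArg range (funext fun m => ih _))
  | ex φ ih =>
    have hs : (range fun m : v.M => geval v (consEnv m e) φ) ⊆ V :=
      range_subset_iff.2 fun m => geval_mem hV v _ φ
    have hi := geval_mem hV v e φ.ex
    simp only [geval] at hi ⊢
    rw [(hmono.monotoneOn.mono hs).map_csSup_of_continuousWithinAt
      ((hcont _ hi).mono hs) (range_nonempty _) (hba _ hs), ← range_comp]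
    exact congrArg sSup (congrArg range (funext fun m => ih _))

theorem GLogic_subset_of_embedding {ar : ℕ → ℕ} {V W : Set ℝ} (hV : GodelSet V) (hW : GodelSet W)
    {g : ℝ → ℝ} (hg : MapsTo g V W) (hmono : StrictMonoOn g V) (hcont : ContinuousOn g V)
    (h0 : g 0 = 0) (h1 : g 1 = 1) : GLogic ar W ⊆ GLogic ar V := by
  rintro φ ⟨hφ, hn⟩
  have hval : ∀ v : GValuation ar V, v.val φ = 1 := by
    intro v
    have hle : GNorm ar W φ ≤ (v.map g hg).val φ :=
      csInf_le (bddBelow_Icc.mono (range_subset_iff.2 fun w => hW.2.1 (geval_mem hW w _ φ)))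
        ⟨_, rfl⟩
    have hge : (v.map g hg).val φ ≤ 1 := (hW.2.1 (geval_mem hW _ _ φ)).2
    have heq : (v.map g hg).val φ = g (v.val φ) := geval_map hV v hg hmono hcont h0 h1 _ φ
    have h2 : g (v.val φ) = g 1 := heq ▸ h1.symm ▸ le_antisymm hge (hn ▸ hle)
    exact hmono.injOn (geval_mem hV v _ φ) hV.2.2.2 h2
  refine ⟨hφ, ?_⟩
  have : Nonempty (GValuation ar V) := ⟨⟨Unit, ⟨()⟩, fun _ _ => 0, fun _ _ => hV.2.2.1⟩⟩
  rw [GNorm, funext hval, range_const, csInf_singleton]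

/-! ### Coding Gödel sets -/

theorem Code.NodeAt.lt_left {V : Set ℝ} {f : Bool → ℕ → Code} {y x z : ℝ}
    (h : Code.NodeAt V f y x z) : y < x := h.2.2.1.lt

theorem Code.NodeAt.lt_right {V : Set ℝ} {f : Bool → ℕ → Code} {y x z : ℝ}
    (h : Code.NodeAt V f y x z) : x < z := neg_lt_neg_iff.1 h.2.2.2.lt

theorem Code.At.eq_empty {V : Set ℝ} {t : Code} {a b : ℝ} (h : t.At V a b)
    (hV : V ∩ Ioo a b = ∅) : t = .empty := by
  cases t with
  | empty => rfl
  | node f =>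
    obtain ⟨x, hx⟩ := Code.at_node.1 h
    exact (hV.subset ⟨hx.1, hx.lt_left, hx.lt_right⟩).elim

theorem Code.NodeAt.eq_empty_of_left {V : Set ℝ} {f : Bool → ℕ → Code} {y x z : ℝ}
    (h : Code.NodeAt V f y x z) (hV : V ∩ Iio x = ∅) (i : ℕ) : f true i = .empty := by
  obtain ⟨-, -, ⟨u, rfl, hu, hux, -, hN⟩, -⟩ := h
  refine (hN i).eq_empty (subset_empty_iff.1 (hV ▸ inter_subset_inter_right _ fun p hp => ?_))
  exact hp.2.trans_le (hu.monotone.ge_of_tendsto hux _)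

theorem Code.NodeAt.eq_empty_of_right {V : Set ℝ} {f : Bool → ℕ → Code} {y x z : ℝ}
    (h : Code.NodeAt V f y x z) (hV : V ∩ Ioi x = ∅) (i : ℕ) : f false i = .empty := by
  obtain ⟨-, -, -, ⟨u, -, hu, hux, -, hN⟩⟩ := h
  refine (hN i).eq_empty (subset_empty_iff.1 (hV ▸ inter_subset_inter_right _ fun p hp => ?_))
  exact (le_neg.1 (hu.monotone.ge_of_tendsto hux _)).trans_lt hp.1

/-- The Gödel set `V` is described by nodes at `0` and `1` and a list of codes in between. -/
def GodelAt (V : Set ℝ) (f : Bool → ℕ → Code) (l : List Code) (f' : Bool → ℕ → Code) : Prop :=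
  (∀ i, f true i = .empty) ∧ (∀ i, f' false i = .empty) ∧ ∃ y w w' z, V ⊆ Ioo y z ∧ w ∉ V ∧
    w' ∉ V ∧ w ≤ w' ∧ Code.NodeAt V f y 0 w ∧ ListAt V l w w' ∧ Code.NodeAt V f' w' 1 z

theorem GodelSet.exists_godelAt {V : Set ℝ} (hV : GodelSet V) (hc : V.Countable) :
    ∃ f l f', GodelAt V f l f' := by
  obtain ⟨hcl, hI, h0, h1⟩ := hV
  obtain ⟨d, hdV, hd0, hd1⟩ := (hc.dense_compl ℝ).exists_between (zero_lt_one' ℝ)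
  have hneg : (-1 : ℝ) ∉ V := fun h => by linarith [(hI h).1]
  have htwo : (2 : ℝ) ∉ V := fun h => by linarith [(hI h).2]
  obtain ⟨f, y, w, -, hw, -, hy, -, hwd, -, hSw, hf⟩ := exists_nodeAt hc (neg_one_lt_zero) hd0 hneg
    h0 hdV (fun p q hp hq _ hpq _ => coded_of_countable hc hcl hp hq hpq)
    (fun p q hp hq _ hpq _ => coded_of_countable hc hcl hp hq hpq)
  obtain ⟨f', w', z, hw', -, hdw, -, hz, -, hSd, -, hf'⟩ := exists_nodeAt hc hd1 one_lt_two hdV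
    h1 htwo (fun p q hp hq _ hpq _ => coded_of_countable hc hcl hp hq hpq)
    (fun p q hp hq _ hpq _ => coded_of_countable hc hcl hp hq hpq)
  obtain ⟨l, hl⟩ := Coded.exists_listAt (hSw.trans hSd)
  refine ⟨f, l, f', hf.eq_empty_of_left ?_, hf'.eq_empty_of_right ?_, y, w, w', z,
    fun p hp => ⟨hy.trans_le (hI hp).1, (hI hp).2.trans_lt hz⟩, hw, hw', (hwd.trans hdw).le,
    hf, hl, hf'⟩
  · exact eq_empty_of_forall_notMem fun p hp => not_lt.2 (hI hp.1).1 hp.2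
  · exact eq_empty_of_forall_notMem fun p hp => not_lt.2 (hI hp.1).2 hp.2

theorem GodelAt.exists_isEmb {V V' : Set ℝ} {f f₁ f' f₁' : Bool → ℕ → Code} {l l' : List Code}
    (h : GodelAt V f l f₁) (h' : GodelAt V' f' l' f₁') (hf : Code.Le (.node f) (.node f'))
    (hl : List.SublistForall₂ Code.Le l l') (hf₁ : Code.Le (.node f₁) (.node f₁')) :
    ∃ g, IsEmb g V V' ∧ g 0 = 0 ∧ g 1 = 1 := by
  obtain ⟨e, e₁, y, w, v, z, hV, hw, hv, hwv, hn, hm, hn₁⟩ := h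
  obtain ⟨e', e₁', y', w', v', z', hV', hw', hv', hwv', hn', hm', hn₁'⟩ := h'
  obtain ⟨g₀, hg₀, hg₀0⟩ := hn.exists_isEmb hn' (fun _ _ _ h => h.embeds)
    (hf.exists_of_empty e e')
  obtain ⟨g₁, hg₁, hg₁1⟩ := hn₁.exists_isEmb hn₁' (fun _ _ _ h => h.embeds)
    (hf₁.exists_of_empty e₁ e₁')
  obtain ⟨g₂, hg₂⟩ := ListAt.exists_isEmb hl hm hm'
  have hyw := hn.lt_left.trans hn.lt_right
  have hyw' := hn'.lt_left.trans hn'.lt_right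
  obtain ⟨g₃, hg₃, hg₃0, -⟩ := exists_isEmb_Ioo hg₀ hg₂ hw hyw.le hwv hw' hyw'.le hwv'
  obtain ⟨g, hg, hgg₃, hgg₁⟩ := exists_isEmb_Ioo hg₃ hg₁ hv (hyw.le.trans hwv)
    (hn₁.lt_left.trans hn₁.lt_right).le hv' (hyw'.le.trans hwv')
    (hn₁'.lt_left.trans hn₁'.lt_right).le
  rw [inter_eq_left.2 hV, inter_eq_left.2 hV'] at hg
  have h0 : (0 : ℝ) ∈ V ∩ Ioo y w := ⟨hn.1, hn.lt_left, hn.lt_right⟩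
  refine ⟨g, hg, ?_, ?_⟩
  · rw [hgg₃ ⟨h0.1, h0.2.1, h0.2.2.trans_le hwv⟩, hg₃0 h0, hg₀0]
  · rw [hgg₁ ⟨hn₁.1, hn₁.lt_left, hn₁.lt_right⟩, hg₁1]

theorem wellQuasiOrdered_sublistForall₂ :
    WellQuasiOrdered (List.SublistForall₂ Code.Le) := by
  have := Set.PartiallyWellOrderedOn.partiallyWellOrderedOn_sublistForall₂ Code.Le
    (partiallyWellOrderedOn_univ_iff.2 Code.wellQuasiOrdered_le)
  simpa [partiallyWellOrderedOn_univ_iff] using this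

/-- Every infinite sequence of Gödel logics determined by countable Gödel sets is
good w.r.t. reverse inclusion: the countable-valued Gödel logics are wqo by `⊇`. -/
theorem stmt16 (ar : ℕ → ℕ) (V : ℕ → Set ℝ)
    (hV : ∀ n, GodelSet (V n)) (hc : ∀ n, (V n).Countable) :
    ∃ n m, n < m ∧ GLogic ar (V m) ⊆ GLogic ar (V n) := by
  choose f l f' h using fun n => (hV n).exists_godelAt (hc n)
  obtain ⟨n, m, hnm, hf, hf', hl⟩ := (Code.wellQuasiOrdered_le.prod
    (Code.wellQuasiOrdered_le.prod wellQuasiOrdered_sublistForall₂))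
    fun n => (.node (f n), .node (f' n), l n)
  obtain ⟨g, ⟨hmono, hmaps, hcont⟩, h0, h1⟩ := (h n).exists_isEmb (h m) hf hl hf'
  exact ⟨n, m, hnm, GLogic_subset_of_embedding (hV n) (hV m) hmaps hmono hcont h0 h1⟩
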